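/- Let N ≥ 2, let t be a real number with 0 ≤ t < N, and let 0 < α < α_{N,t} := (N-t)·ω_{N-1}^{1/(N-1)}. Then there exists a positive constant C = C(N,t,α) such that for every function u ∈ L^N(ℝ^N;|x|^{-t}dx) ∩ Ẇ^{1,N}(ℝ^N) (not assumed radially symmetric) with ∫_{ℝ^N}|∇u|^N dx ≤ 1, one has ∫_{ℝ^N} Φ_N(α|u(x)|^{N/(N-1)}) |x|^{-t} dx ≤ C ∫_{ℝ^N} |u(x)|^N |x|^{-t} dx. -/

import Mathlib

open MeasureTheory Real

/-- Surface area of the unit sphere `S^{N-1}` in `ℝ^N`, i.e. `ω_{N-1} = N · vol(B(0,1))`. -/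
noncomputable def sphereArea (N : ℕ) : ℝ :=
  N * (volume (Metric.ball (0 : EuclideanSpace ℝ (Fin N)) 1)).toReal

/-- `Φ_N(τ) = Σ_{j ≥ N-1} τ^j / j!`, the exponential series with the first `N-1` terms removed. -/
noncomputable def PhiN (N : ℕ) (τ : ℝ) : ℝ :=
  ∑' j : ℕ, τ ^ (j + (N - 1)) / (Nat.factorial (j + (N - 1)) : ℝ)

/-- `g` is the weak gradient of `u` on `ℝ^N`: both are locally integrable and the
integration-by-parts identity holds against all smooth compactly supported test functions. -/
def HasWeakGradient {N : ℕ} (u : EuclideanSpace ℝ (Fin N) → ℝ)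
    (g : EuclideanSpace ℝ (Fin N) → EuclideanSpace ℝ (Fin N)) : Prop :=
  LocallyIntegrable u volume ∧ LocallyIntegrable g volume ∧
  ∀ φ : EuclideanSpace ℝ (Fin N) → ℝ, ContDiff ℝ (⊤ : ℕ∞) φ → HasCompactSupport φ →
    ∀ i : Fin N,
      ∫ x, u x * fderiv ℝ φ x (EuclideanSpace.single i 1) = - ∫ x, g x i * φ x

/-- Euclidean space `ℝ^N`. -/
abbrev Euc (N : ℕ) := EuclideanSpace ℝ (Fin N)

lemma sphereArea_pos {N : ℕ} (hN : 2 ≤ N) : 0 < sphereArea N := by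
  have : 0 < (volume (Metric.ball (0 : Euc N) 1)).toReal :=
    ENNReal.toReal_pos (Metric.measure_ball_pos volume _ one_pos).ne' measure_ball_lt_top.ne
  have hN' : (0 : ℝ) < N := by exact_mod_cast (by omega : 0 < N)
  exact mul_pos hN' this

lemma integral_norm_eq_sphereArea_mul {N : ℕ} (hN : 2 ≤ N) (f : ℝ → ℝ) :
    ∫ x : Euc N, f ‖x‖ = sphereArea N * ∫ y in Set.Ioi (0 : ℝ), y ^ (N - 1) * f y := by
  have : Nonempty (Fin N) := ⟨⟨0, by omega⟩⟩
  rw [integral_fun_norm_addHaar volume f]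
  simp [sphereArea, Measure.real, mul_assoc]

/-- The integral of a power of the norm over a spherical shell. -/
lemma lintegral_shell_norm_rpow {N : ℕ} (hN : 2 ≤ N) {a b c : ℝ} (ha : 0 ≤ a) (hab : a ≤ b)
    (hint : IntervalIntegrable (fun y : ℝ => y ^ ((N : ℝ) - 1 + c)) volume a b) :
    ∫⁻ x in {x : Euc N | a < ‖x‖ ∧ ‖x‖ < b}, ENNReal.ofReal (‖x‖ ^ c)
      = ENNReal.ofReal (sphereArea N * ∫ y in a..b, y ^ ((N : ℝ) - 1 + c)) := by
  have : Nonempty (Fin N) := ⟨⟨0, by omega⟩⟩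
  have hmeas : MeasurableSet {x : Euc N | a < ‖x‖ ∧ ‖x‖ < b} :=
    (isOpen_lt continuous_const continuous_norm).measurableSet.inter
      (isOpen_lt continuous_norm continuous_const).measurableSet
  set F : ℝ → ℝ := (Set.Ioo a b).indicator (fun y => y ^ c) with hF
  have key : ∀ y ∈ Set.Ioi (0 : ℝ), y ^ (N - 1) * F y
      = (Set.Ioo a b).indicator (fun y : ℝ => y ^ ((N : ℝ) - 1 + c)) y := by
    intro y hy
    by_cases h : y ∈ Set.Ioo a b
    · rw [hF, Set.indicator_of_mem h, Set.indicator_of_mem h, Real.rpow_add hy,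
        ← Real.rpow_natCast, Nat.cast_sub (by omega), Nat.cast_one]
    · rw [hF, Set.indicator_of_notMem h, Set.indicator_of_notMem h, mul_zero]
  have hsub : Set.Ioo a b ⊆ Set.Ioi 0 := fun y hy => lt_of_le_of_lt ha hy.1
  have hI : IntegrableOn (fun y => y ^ (N - 1) * F y) (Set.Ioi 0) := by
    rw [integrableOn_congr_fun key measurableSet_Ioi]
    refine Integrable.integrableOn ?_
    rw [integrable_indicator_iff measurableSet_Ioo]
    exact ((intervalIntegrable_iff_integrableOn_Ioo_of_le hab).1 hint)
  have hInt : Integrable (fun x : Euc N => F ‖x‖) := by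
    rw [integrable_fun_norm_addHaar volume]
    simpa using hI
  have hF0 : ∀ y, 0 ≤ F y := fun y =>
    Set.indicator_nonneg (fun z hz => Real.rpow_nonneg (ha.trans hz.1.le) _) y
  have e1 : ∫ x : Euc N, F ‖x‖ = sphereArea N * ∫ y in a..b, y ^ ((N : ℝ) - 1 + c) := by
    rw [integral_norm_eq_sphereArea_mul hN, setIntegral_congr_fun measurableSet_Ioi key,
      setIntegral_indicator measurableSet_Ioo, Set.inter_eq_right.2 hsub,
      intervalIntegral.integral_of_le hab, integral_Ioc_eq_integral_Ioo]
  rw [← e1, ofReal_integral_eq_lintegral_ofReal hInt (Filter.Eventually.of_forall fun x => hF0 _),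
    ← lintegral_indicator hmeas]
  refine lintegral_congr fun x => ?_
  by_cases h : a < ‖x‖ ∧ ‖x‖ < b
  · rw [Set.indicator_of_mem (by exact h), hF, Set.indicator_of_mem (by exact h)]
  · rw [Set.indicator_of_notMem (by exact h), hF, Set.indicator_of_notMem (by exact h),
      ENNReal.ofReal_zero]

/-- The integral of a power of the norm over a ball centred at the origin. -/
lemma lintegral_ball_norm_rpow {N : ℕ} (hN : 2 ≤ N) {b c : ℝ} (hb : 0 ≤ b)
    (hc : 0 < (N : ℝ) + c) :
    ∫⁻ x in Metric.ball (0 : Euc N) b, ENNReal.ofReal (‖x‖ ^ c)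
      = ENNReal.ofReal (sphereArea N * (b ^ ((N : ℝ) + c) / ((N : ℝ) + c))) := by
  have : Nonempty (Fin N) := ⟨⟨0, by omega⟩⟩
  have h1 : (-1 : ℝ) < (N : ℝ) - 1 + c := by linarith
  have := lintegral_shell_norm_rpow hN (c := c) le_rfl hb
    (intervalIntegral.intervalIntegrable_rpow' h1)
  rw [integral_rpow (Or.inl h1), show (N : ℝ) - 1 + c + 1 = N + c by ring,
    Real.zero_rpow hc.ne', sub_zero] at this
  rw [← this]
  refine setLIntegral_congr ?_
  have h0 : ∀ᵐ x : Euc N, x ≠ 0 := by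
    simp [ae_iff, measure_singleton]
  filter_upwards [h0] with x hx
  simp only [eq_iff_iff]
  change x ∈ Metric.ball 0 b ↔ 0 < ‖x‖ ∧ ‖x‖ < b
  simp [hx]

/-- The borderline power `‖x‖ ^ (-N)` has logarithmic integral over shells. -/
lemma lintegral_shell_norm_rpow_neg {N : ℕ} (hN : 2 ≤ N) {a b : ℝ} (ha : 0 < a) (hab : a ≤ b) :
    ∫⁻ x in {x : Euc N | a < ‖x‖ ∧ ‖x‖ < b}, ENNReal.ofReal (‖x‖ ^ (-(N : ℝ)))
      = ENNReal.ofReal (sphereArea N * Real.log (b / a)) := by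
  have h0 : (0 : ℝ) ∉ Set.uIcc a b := by
    rw [Set.uIcc_of_le hab]; exact fun h => absurd h.1 (not_le.2 ha)
  rw [lintegral_shell_norm_rpow hN ha.le hab
    (intervalIntegral.intervalIntegrable_rpow (Or.inr h0)),
    show (N : ℝ) - 1 + -N = -1 by ring]
  simp_rw [Real.rpow_neg_one]
  rw [integral_inv h0]

/-- A smooth monotone cutoff vanishing on `(-∞, 1/2]` and equal to `1` on `[1, ∞)`. -/
noncomputable def smoothCutoff (s : ℝ) : ℝ := Real.smoothTransition (2 * s - 1)

lemma smoothCutoff_contDiff : ContDiff ℝ (⊤ : ℕ∞) smoothCutoff :=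
  Real.smoothTransition.contDiff.comp ((contDiff_const.mul contDiff_id).sub contDiff_const)

lemma smoothCutoff_nonneg (s : ℝ) : 0 ≤ smoothCutoff s := Real.smoothTransition.nonneg _

lemma smoothCutoff_le_one (s : ℝ) : smoothCutoff s ≤ 1 := Real.smoothTransition.le_one _

lemma smoothCutoff_eq_zero {s : ℝ} (hs : s ≤ 1 / 2) : smoothCutoff s = 0 :=
  Real.smoothTransition.zero_of_nonpos (by linarith)

lemma smoothCutoff_eq_one {s : ℝ} (hs : 1 ≤ s) : smoothCutoff s = 1 :=
  Real.smoothTransition.one_of_one_le (by linarith)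

lemma smoothCutoff_monotone : Monotone smoothCutoff := fun a b hab =>
  Real.smoothTransition.monotone (by linarith)

lemma deriv_smoothCutoff_eq_zero_of_le {s : ℝ} (hs : s ≤ 1 / 2) : deriv smoothCutoff s = 0 :=
  IsLocalMin.deriv_eq_zero (Filter.Eventually.of_forall fun x => by
    rw [smoothCutoff_eq_zero hs]; exact smoothCutoff_nonneg x)

lemma deriv_smoothCutoff_eq_zero_of_ge {s : ℝ} (hs : 1 ≤ s) : deriv smoothCutoff s = 0 :=
  IsLocalMax.deriv_eq_zero (Filter.Eventually.of_forall fun x => by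
    rw [smoothCutoff_eq_one hs]; exact smoothCutoff_le_one x)

lemma smoothCutoff_hasDerivAt (s : ℝ) : HasDerivAt smoothCutoff (deriv smoothCutoff s) s :=
  (smoothCutoff_contDiff.differentiable (by simp) s).hasDerivAt

lemma exists_abs_deriv_smoothCutoff_le : ∃ K, 0 ≤ K ∧ ∀ s, |deriv smoothCutoff s| ≤ K := by
  have hc : Continuous (deriv smoothCutoff) := smoothCutoff_contDiff.continuous_deriv (by simp)
  obtain ⟨K, hK⟩ := (isCompact_Icc (a := (1 / 2 : ℝ)) (b := 1)).exists_bound_of_continuousOn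
    hc.continuousOn
  have hK0 : 0 ≤ K := (norm_nonneg _).trans (hK 1 (by norm_num))
  refine ⟨K, hK0, fun s => ?_⟩
  rcases le_or_gt s (1 / 2) with h | h
  · simpa [deriv_smoothCutoff_eq_zero_of_le h] using hK0
  rcases le_or_gt 1 s with h' | h'
  · simpa [deriv_smoothCutoff_eq_zero_of_ge h'] using hK0
  · exact hK s ⟨h.le, h'.le⟩

/-- The field `z / ‖z‖^N`, smoothly cut off inside the ball of radius `a`. -/
noncomputable def radialField (N : ℕ) (a : ℝ) (z : Euc N) : Euc N :=
  ((‖z‖ ^ 2) ^ (-(N : ℝ) / 2) * smoothCutoff (‖z‖ ^ 2 / a ^ 2)) • z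

/-- The divergence of `radialField N a`: a bump of total mass `sphereArea N` in the ball of
radius `a`. -/
noncomputable def radialBump (N : ℕ) (a : ℝ) (z : Euc N) : ℝ :=
  2 * (‖z‖ ^ 2) ^ (1 - (N : ℝ) / 2) * deriv smoothCutoff (‖z‖ ^ 2 / a ^ 2) / a ^ 2

lemma radialField_eventuallyEq_zero (N : ℕ) (a : ℝ) :
    radialField N a =ᶠ[nhds 0] fun _ => 0 := by
  have : ContinuousAt (fun z : Euc N => ‖z‖ ^ 2 / a ^ 2) 0 := by fun_prop
  have h := this.eventually_lt (continuousAt_const (y := (1 / 2 : ℝ))) (by simp)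
  filter_upwards [h] with z hz
  simp [radialField, smoothCutoff_eq_zero hz.le]

lemma radialField_contDiff (N : ℕ) (a : ℝ) :
    ContDiff ℝ (⊤ : ℕ∞) (radialField N a) := by
  rw [contDiff_iff_contDiffAt]
  intro z
  by_cases hz : z = 0
  · subst hz
    exact contDiffAt_const.congr_of_eventuallyEq (radialField_eventuallyEq_zero N a)
  · have h1 : ContDiffAt ℝ (⊤ : ℕ∞) (fun z : Euc N => ‖z‖ ^ 2) z := (contDiff_norm_sq ℝ).contDiffAt
    have h2 := h1.rpow_const_of_ne (p := -(N : ℝ) / 2) (by simpa using hz)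
    have h3 := smoothCutoff_contDiff.contDiffAt.comp z (h1.div_const (a ^ 2))
    exact (h2.mul h3).smul contDiffAt_id

lemma sum_fderiv_radialField (N : ℕ) (a : ℝ) (z : Euc N) :
    ∑ i, fderiv ℝ (fun z => radialField N a z i) z (EuclideanSpace.single i 1)
      = radialBump N a z := by
  by_cases hz : z = 0
  · subst hz
    have : ∀ i, fderiv ℝ (fun z => radialField N a z i) 0 = 0 := fun i => by
      have : (fun z => radialField N a z i) =ᶠ[nhds 0] fun _ => (0 : ℝ) := by
        filter_upwards [radialField_eventuallyEq_zero N a] with z hz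
        simp [hz]
      rw [this.fderiv_eq]; simp
    simp [this, radialBump, deriv_smoothCutoff_eq_zero_of_le]
  have hpos : 0 < ‖z‖ ^ 2 := by positivity
  set ρ := ‖z‖ ^ 2 with hρ
  set d : ℝ := (-(N : ℝ) / 2) * ρ ^ (-(N : ℝ) / 2 - 1) * smoothCutoff (ρ / a ^ 2)
    + ρ ^ (-(N : ℝ) / 2) * (deriv smoothCutoff (ρ / a ^ 2) / a ^ 2) with hd
  have hQ : HasDerivAt (fun r : ℝ => r ^ (-(N : ℝ) / 2) * smoothCutoff (r / a ^ 2)) d ρ := by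
    have h1 := Real.hasDerivAt_rpow_const (x := ρ) (p := -(N : ℝ) / 2) (Or.inl hpos.ne')
    have h2 := (smoothCutoff_hasDerivAt (ρ / a ^ 2)).comp ρ ((hasDerivAt_id ρ).div_const (a ^ 2))
    refine (h1.mul h2).congr_deriv ?_
    simp [hd, div_eq_mul_inv]
  have hs : HasFDerivAt (fun z : Euc N => ‖z‖ ^ 2) (2 • innerSL ℝ z) z :=
    (hasStrictFDerivAt_norm_sq z).hasFDerivAt
  have hc := hQ.comp_hasFDerivAt z hs
  have hi : ∀ i, fderiv ℝ (fun z => radialField N a z i) z (EuclideanSpace.single i 1)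
      = ρ ^ (-(N : ℝ) / 2) * smoothCutoff (ρ / a ^ 2) + 2 * d * z i ^ 2 := fun i => by
    have hp : HasFDerivAt (fun z : Euc N => z i) (EuclideanSpace.proj i : Euc N →L[ℝ] ℝ) z :=
      (EuclideanSpace.proj i : Euc N →L[ℝ] ℝ).hasFDerivAt
    have := hc.mul hp
    have e : (fun z => radialField N a z i) = (fun z : Euc N =>
      ((fun r : ℝ => r ^ (-(N : ℝ) / 2) * smoothCutoff (r / a ^ 2)) ∘ fun z : Euc N => ‖z‖ ^ 2) z
        * z i) := by
      ext z; simp [radialField]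
    rw [e]
    refine (DFunLike.congr_fun (HasFDerivAt.fderiv this) _).trans ?_
    simp [EuclideanSpace.inner_single_right, ← hρ]
    ring
  simp_rw [hi]
  rw [Finset.sum_add_distrib, ← Finset.mul_sum (a := 2 * d), ← EuclideanSpace.real_norm_sq_eq, ← hρ]
  simp only [Finset.sum_const, Finset.card_univ, Fintype.card_fin, nsmul_eq_mul, radialBump, ← hρ,
    hd]
  have e1 : ρ ^ (-(N : ℝ) / 2) = ρ ^ (-(N : ℝ) / 2 - 1) * ρ := by
    rw [← Real.rpow_add_one hpos.ne']; ring_nf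
  have e2 : ρ ^ (1 - (N : ℝ) / 2) = ρ ^ (-(N : ℝ) / 2 - 1) * ρ * ρ := by
    rw [← Real.rpow_add_one hpos.ne', ← Real.rpow_add_one hpos.ne']; ring_nf
  rw [e1, e2]
  ring

lemma radialBump_continuous (N : ℕ) (a : ℝ) : Continuous (radialBump N a) := by
  have : radialBump N a = fun z =>
      ∑ i, fderiv ℝ (fun z => radialField N a z i) z (EuclideanSpace.single i 1) :=
    funext fun z => (sum_fderiv_radialField N a z).symm
  rw [this]
  refine continuous_finsetSum _ fun i _ => ?_
  exact ((contDiff_euclidean.1 (radialField_contDiff N a) i).continuous_fderiv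
    (by simp)).clm_apply continuous_const

lemma radialBump_eq_zero (N : ℕ) {a : ℝ} (ha : 0 < a) {z : Euc N} (hz : a ≤ ‖z‖) :
    radialBump N a z = 0 := by
  have : 1 ≤ ‖z‖ ^ 2 / a ^ 2 := by
    rw [one_le_div (by positivity)]; gcongr
  simp [radialBump, deriv_smoothCutoff_eq_zero_of_ge this]

lemma exists_abs_radialBump_le {N : ℕ} (hN : 2 ≤ N) :
    ∃ K : ℝ, 0 ≤ K ∧ ∀ a : ℝ, 0 < a → ∀ z : Euc N, |radialBump N a z| ≤ K * (a ^ N)⁻¹ := by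
  obtain ⟨K, hK0, hK⟩ := exists_abs_deriv_smoothCutoff_le
  refine ⟨2 * (1 / 2 : ℝ) ^ (1 - (N : ℝ) / 2) * K, by positivity, fun a ha z => ?_⟩
  have hN' : (2 : ℝ) ≤ N := by exact_mod_cast hN
  have hexp : 1 - (N : ℝ) / 2 ≤ 0 := by linarith
  rcases le_or_gt (‖z‖ ^ 2 / a ^ 2) (1 / 2) with h | h
  · simp only [radialBump, deriv_smoothCutoff_eq_zero_of_le h]
    simp only [mul_zero, zero_div, abs_zero]
    positivity
  have ha2 : 0 < a ^ 2 := by positivity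
  have h1 : (‖z‖ ^ 2) ^ (1 - (N : ℝ) / 2) ≤ (1 / 2 * a ^ 2) ^ (1 - (N : ℝ) / 2) :=
    Real.rpow_le_rpow_of_nonpos (by positivity) ((lt_div_iff₀ ha2).1 h).le hexp
  have h2 : (1 / 2 * a ^ 2) ^ (1 - (N : ℝ) / 2) / a ^ 2
      = (1 / 2 : ℝ) ^ (1 - (N : ℝ) / 2) * (a ^ N)⁻¹ := by
    rw [Real.mul_rpow (by norm_num) ha2.le, Real.rpow_sub ha2, Real.rpow_one,
      ← Real.rpow_natCast a 2, ← Real.rpow_mul ha.le, ← Real.rpow_natCast a N]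
    have : ((2 : ℕ) : ℝ) * ((N : ℝ) / 2) = N := by push_cast; ring
    rw [this]
    have : a ^ ((2 : ℕ) : ℝ) ≠ 0 := (Real.rpow_pos_of_pos ha _).ne'
    field_simp
  rw [radialBump, abs_div, abs_mul, abs_mul, abs_of_pos ha2, abs_two,
    abs_of_nonneg (Real.rpow_nonneg (sq_nonneg _) _)]
  calc 2 * (‖z‖ ^ 2) ^ (1 - (N : ℝ) / 2) * |deriv smoothCutoff (‖z‖ ^ 2 / a ^ 2)| / a ^ 2
      ≤ 2 * (1 / 2 * a ^ 2) ^ (1 - (N : ℝ) / 2) * K / a ^ 2 := by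
        gcongr; exact hK _
    _ = 2 * ((1 / 2 * a ^ 2) ^ (1 - (N : ℝ) / 2) / a ^ 2) * K := by ring
    _ = _ := by rw [h2]; ring

lemma integral_radialBump {N : ℕ} (hN : 2 ≤ N) {a : ℝ} (ha : 0 < a) :
    ∫ z, radialBump N a z = sphereArea N := by
  have := integral_norm_eq_sphereArea_mul hN (fun y : ℝ =>
    2 * (y ^ 2) ^ (1 - (N : ℝ) / 2) * deriv smoothCutoff (y ^ 2 / a ^ 2) / a ^ 2)
  simp only [radialBump]
  rw [this]
  have key : ∀ y ∈ Set.Ioi (0 : ℝ), y ^ (N - 1) *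
      (2 * (y ^ 2) ^ (1 - (N : ℝ) / 2) * deriv smoothCutoff (y ^ 2 / a ^ 2) / a ^ 2)
      = deriv smoothCutoff (y ^ 2 / a ^ 2) * (2 * y / a ^ 2) := by
    intro y (hy : 0 < y)
    have e : y ^ (N - 1) * (y ^ 2) ^ (1 - (N : ℝ) / 2) = y := by
      rw [← Real.rpow_natCast y 2, ← Real.rpow_mul hy.le, ← Real.rpow_natCast, ← Real.rpow_add hy,
        Nat.cast_sub (by omega)]
      conv_rhs => rw [← Real.rpow_one y]
      congr 1; push_cast; ring
    calc _ = (y ^ (N - 1) * (y ^ 2) ^ (1 - (N : ℝ) / 2)) *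
        (2 * deriv smoothCutoff (y ^ 2 / a ^ 2) / a ^ 2) := by ring
      _ = _ := by rw [e]; ring
  rw [setIntegral_congr_fun measurableSet_Ioi key]
  have hd : ∀ y : ℝ, HasDerivAt (fun y : ℝ => smoothCutoff (y ^ 2 / a ^ 2))
      (deriv smoothCutoff (y ^ 2 / a ^ 2) * (2 * y / a ^ 2)) y := fun y => by
    have h2 : HasDerivAt (fun y : ℝ => y ^ 2 / a ^ 2) (2 * y / a ^ 2) y := by
      simpa using (hasDerivAt_pow 2 y).div_const (a ^ 2)
    exact (smoothCutoff_hasDerivAt _).comp y h2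
  rw [integral_Ioi_of_hasDerivAt_of_nonneg (l := 1) (hd 0).continuousAt.continuousWithinAt
    (fun y _ => hd y)]
  · simp [smoothCutoff_eq_zero]
  · intro y (hy : 0 < y)
    exact mul_nonneg smoothCutoff_monotone.deriv_nonneg (by positivity)
  · refine tendsto_const_nhds.congr' ?_
    filter_upwards [Filter.eventually_ge_atTop a] with y hy
    rw [smoothCutoff_eq_one]
    rw [one_le_div (by positivity)]; gcongr

lemma radialField_sub_eq_zero (N : ℕ) {a b : ℝ} (ha : 0 < a) (hab : a ≤ b) {z : Euc N}
    (hz : b ≤ ‖z‖) : radialField N a z - radialField N b z = 0 := by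
  have hb : 0 < b := ha.trans_le hab
  have h1 : 1 ≤ ‖z‖ ^ 2 / a ^ 2 := by
    rw [one_le_div (by positivity)]; gcongr; linarith
  have h2 : 1 ≤ ‖z‖ ^ 2 / b ^ 2 := by
    rw [one_le_div (by positivity)]; gcongr
  simp [radialField, smoothCutoff_eq_one h1, smoothCutoff_eq_one h2]

lemma norm_radialField_sub_le (N : ℕ) (a b : ℝ) (z : Euc N) :
    ‖radialField N a z - radialField N b z‖ ≤ ‖z‖ ^ (1 - (N : ℝ)) := by
  by_cases hz : z = 0
  · subst hz; simp [radialField]; positivity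
  have hpos : 0 < ‖z‖ := by positivity
  have e : (‖z‖ ^ 2) ^ (-(N : ℝ) / 2) * ‖z‖ = ‖z‖ ^ (1 - (N : ℝ)) := by
    rw [← Real.rpow_natCast ‖z‖ 2, ← Real.rpow_mul hpos.le, ← Real.rpow_add_one hpos.ne']
    congr 1; push_cast; ring
  rw [radialField, radialField, ← sub_smul, ← mul_sub, norm_smul, ← e, norm_mul, Real.norm_eq_abs,
    abs_of_nonneg (by positivity)]
  have : ‖smoothCutoff (‖z‖ ^ 2 / a ^ 2) - smoothCutoff (‖z‖ ^ 2 / b ^ 2)‖ ≤ 1 := by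
    rw [Real.norm_eq_abs, abs_le]
    constructor <;> linarith [smoothCutoff_nonneg (‖z‖ ^ 2 / a ^ 2),
      smoothCutoff_nonneg (‖z‖ ^ 2 / b ^ 2), smoothCutoff_le_one (‖z‖ ^ 2 / a ^ 2),
      smoothCutoff_le_one (‖z‖ ^ 2 / b ^ 2)]
  have h0 : 0 ≤ (‖z‖ ^ 2) ^ (-(N : ℝ) / 2) := by positivity
  nlinarith [mul_nonneg h0 hpos.le]

lemma HasWeakGradient.integral_mul_radialBump {N : ℕ} {u : Euc N → ℝ} {g : Euc N → Euc N}
    (h : HasWeakGradient u g) {a b : ℝ} (ha : 0 < a) (hab : a ≤ b) (x : Euc N) :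
    ∫ y, u y * radialBump N a (y - x) = (∫ y, u y * radialBump N b (y - x))
      - ∫ y, inner ℝ (g y) (radialField N a (y - x) - radialField N b (y - x)) := by
  obtain ⟨hu, hg, hw⟩ := h
  have hb : 0 < b := ha.trans_le hab
  have hsupp : ∀ c, 0 < c → HasCompactSupport fun y => radialBump N c (y - x) := fun c hc =>
    HasCompactSupport.intro (isCompact_closedBall x c) fun y hy =>
      radialBump_eq_zero N hc (by
        rw [Metric.mem_closedBall, dist_eq_norm, not_le] at hy; exact hy.le)
  have hint : ∀ c, 0 < c → Integrable fun y => u y * radialBump N c (y - x) := fun c hc =>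
    hu.integrable_smul_right_of_hasCompactSupport
      ((radialBump_continuous N c).comp (continuous_id.sub continuous_const)) (hsupp c hc)
  set φ : Fin N → Euc N → ℝ := fun i y =>
    (radialField N a (y - x) - radialField N b (y - x)) i with hφ
  have hcd : ∀ c i, ContDiff ℝ (⊤ : ℕ∞) fun z => radialField N c z i := fun c i =>
    contDiff_euclidean.1 (radialField_contDiff N c) i
  have hφs : ∀ i, ContDiff ℝ (⊤ : ℕ∞) (φ i) := fun i =>
    ((hcd a i).comp (contDiff_id.sub contDiff_const)).sub
      ((hcd b i).comp (contDiff_id.sub contDiff_const))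
  have hφc : ∀ i, HasCompactSupport (φ i) := fun i =>
    HasCompactSupport.intro (isCompact_closedBall x b) fun y hy => by
      rw [Metric.mem_closedBall, dist_eq_norm, not_le] at hy
      simp only [hφ, radialField_sub_eq_zero N ha hab hy.le, PiLp.zero_apply]
  have hφd : ∀ y, ∑ i, fderiv ℝ (φ i) y (EuclideanSpace.single i 1)
      = radialBump N a (y - x) - radialBump N b (y - x) := fun y => by
    rw [← sum_fderiv_radialField N a, ← sum_fderiv_radialField N b, ← Finset.sum_sub_distrib]
    refine Finset.sum_congr rfl fun i _ => ?_
    have hd : ∀ c, DifferentiableAt ℝ (fun y => radialField N c (y - x) i) y :=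
      fun c => (((hcd c i).comp (contDiff_id.sub contDiff_const)).differentiable (by simp)) y
    have e : φ i = (fun y => radialField N a (y - x) i) - fun y => radialField N b (y - x) i := by
      ext y; simp [hφ]
    rw [e, fderiv_sub (hd a) (hd b), fderiv_comp_sub (f := fun z => radialField N a z i),
      fderiv_comp_sub (f := fun z => radialField N b z i)]
    rfl
  have hi1 : ∀ i ∈ Finset.univ, Integrable fun y =>
      u y * fderiv ℝ (φ i) y (EuclideanSpace.single i 1) := fun i _ =>
    hu.integrable_smul_right_of_hasCompactSupport
      (((hφs i).continuous_fderiv (by simp)).clm_apply continuous_const)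
      (((hφc i).fderiv (𝕜 := ℝ)).comp_left (g := fun L : Euc N →L[ℝ] ℝ =>
        L (EuclideanSpace.single i 1)) (by simp))
  have hi2 : ∀ i ∈ Finset.univ, Integrable fun y => g y i * φ i y := fun i _ => by
    have := (hg.integrable_smul_left_of_hasCompactSupport (hφs i).continuous (hφc i))
    have := (EuclideanSpace.proj i : Euc N →L[ℝ] ℝ).integrable_comp this
    refine this.congr (Filter.Eventually.of_forall fun y => ?_)
    simp [mul_comm]
  have hsum := Finset.sum_congr rfl fun i (_ : i ∈ Finset.univ) => hw (φ i) (hφs i) (hφc i) i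
  rw [← integral_finsetSum _ hi1, Finset.sum_neg_distrib, ← integral_finsetSum _ hi2] at hsum
  simp_rw [← Finset.mul_sum, hφd, mul_sub] at hsum
  rw [integral_sub (hint a ha) (hint b hb)] at hsum
  have e2 : ∀ y, inner ℝ (g y) (radialField N a (y - x) - radialField N b (y - x))
      = ∑ i, g y i * φ i y := fun y => by
    simp [PiLp.inner_apply, hφ, mul_comm]
  simp_rw [e2]
  linarith

lemma ae_tendsto_integral_mul_radialBump {N : ℕ} (hN : 2 ≤ N) {u : Euc N → ℝ}
    (hu : LocallyIntegrable u volume) :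
    ∀ᵐ x, Filter.Tendsto (fun a => ∫ y, u y * radialBump N a (y - x))
      (nhdsWithin 0 (Set.Ioi 0)) (nhds (u x * sphereArea N)) := by
  obtain ⟨K, hK0, hK⟩ := exists_abs_radialBump_le hN
  filter_upwards [IsUnifLocDoublingMeasure.ae_tendsto_average_norm_sub volume hu 1] with x hx
  have hlim := hx (fun _ : ℝ => x) id Filter.tendsto_id
    (by filter_upwards [self_mem_nhdsWithin] with a ha
        simpa using (le_of_lt (show 0 < a from ha)))
  have hlim2 := hlim.const_mul (K * volume.real (Metric.ball (0 : Euc N) 1))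
  rw [mul_zero] at hlim2
  rw [tendsto_iff_norm_sub_tendsto_zero]
  refine squeeze_zero' (Filter.Eventually.of_forall fun _ => norm_nonneg _) ?_ hlim2
  filter_upwards [self_mem_nhdsWithin] with a (ha : 0 < a)
  have hcont : Continuous fun y => radialBump N a (y - x) :=
    (radialBump_continuous N a).comp (continuous_id.sub continuous_const)
  have hsupp : HasCompactSupport fun y => radialBump N a (y - x) :=
    HasCompactSupport.intro (isCompact_closedBall x a) fun y hy =>
      radialBump_eq_zero N ha (by
        rw [Metric.mem_closedBall, dist_eq_norm, not_le] at hy; exact hy.le)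
  have hi1 : Integrable fun y => u y * radialBump N a (y - x) :=
    hu.integrable_smul_right_of_hasCompactSupport hcont hsupp
  have hi2 : Integrable fun y => u x * radialBump N a (y - x) :=
    (hcont.integrable_of_hasCompactSupport hsupp).const_mul _
  have e : u x * sphereArea N = ∫ y, u x * radialBump N a (y - x) := by
    rw [integral_const_mul, integral_sub_right_eq_self (radialBump N a), integral_radialBump hN ha]
  rw [e, ← integral_sub hi1 hi2]
  have hz : ∀ y, y ∉ Metric.closedBall x a → u y * radialBump N a (y - x)
      - u x * radialBump N a (y - x) = 0 := fun y hy => by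
    rw [Metric.mem_closedBall, dist_eq_norm, not_le] at hy
    rw [radialBump_eq_zero N ha hy.le]; ring
  rw [← setIntegral_eq_integral_of_forall_compl_eq_zero hz]
  have hloc : IntegrableOn (fun y => ‖u y - u x‖) (Metric.closedBall x a) :=
    ((hu.integrableOn_isCompact (isCompact_closedBall x a)).sub
      (integrableOn_const (by exact measure_closedBall_lt_top.ne))).norm
  calc ‖∫ y in Metric.closedBall x a, (u y * radialBump N a (y - x)
        - u x * radialBump N a (y - x))‖
      ≤ ∫ y in Metric.closedBall x a, K * (a ^ N)⁻¹ * ‖u y - u x‖ := by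
        refine norm_integral_le_of_norm_le (hloc.const_mul _) (Filter.Eventually.of_forall
          fun y => ?_)
        rw [← sub_mul, norm_mul, mul_comm]
        gcongr
        exact hK a ha _
    _ = K * volume.real (Metric.ball (0 : Euc N) 1) * ⨍ y in Metric.closedBall x a,
        ‖u y - u x‖ := by
        have hv : 0 < volume.real (Metric.ball (0 : Euc N) 1) :=
          ENNReal.toReal_pos (Metric.measure_ball_pos volume _ one_pos).ne' measure_ball_lt_top.ne
        have hvol : volume.real (Metric.closedBall x a)
            = a ^ N * volume.real (Metric.ball (0 : Euc N) 1) := by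
          rw [Measure.real, Measure.addHaar_closedBall _ _ ha.le, ENNReal.toReal_mul,
            ENNReal.toReal_ofReal (by positivity), finrank_euclideanSpace, Fintype.card_fin,
            Measure.real]
        rw [integral_const_mul, setAverage_eq, hvol, smul_eq_mul]
        field_simp

/-- Pointwise bound of a weakly differentiable function by its local means and the truncated
Riesz potential of its gradient, with the sharp constant in front of the potential. -/
lemma HasWeakGradient.ae_enorm_le {N : ℕ} (hN : 2 ≤ N) :
    ∃ K : ℝ, 0 ≤ K ∧ ∀ (u : Euc N → ℝ) (g : Euc N → Euc N), HasWeakGradient u g →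
      ∀ᵐ x, ∀ R : ℝ, 0 < R → ‖u x‖ₑ * ENNReal.ofReal (sphereArea N) ≤
        ENNReal.ofReal (K * (R ^ N)⁻¹) * (∫⁻ y in Metric.ball x R, ‖u y‖ₑ)
        + ∫⁻ y in Metric.ball x R, ‖g y‖ₑ * ENNReal.ofReal (‖y - x‖ ^ (1 - (N : ℝ))) := by
  obtain ⟨K, hK0, hK⟩ := exists_abs_radialBump_le hN
  refine ⟨K, hK0, fun u g h => ?_⟩
  filter_upwards [ae_tendsto_integral_mul_radialBump hN h.1] with x hx R hR
  have hlim := (continuous_enorm.tendsto _).comp hx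
  rw [enorm_mul, ← ofReal_norm (sphereArea N), Real.norm_of_nonneg (sphereArea_pos hN).le]
    at hlim
  refine le_of_tendsto hlim ?_
  filter_upwards [self_mem_nhdsWithin, mem_nhdsWithin_of_mem_nhds (Iio_mem_nhds hR)]
    with a (ha : 0 < a) (haR : a < R)
  simp only [Function.comp_apply]
  rw [h.integral_mul_radialBump ha haR.le x]
  have hball : MeasurableSet (Metric.ball x R) := measurableSet_ball
  refine (enorm_sub_le).trans (add_le_add ?_ ?_)
  · refine (enorm_integral_le_lintegral_enorm _).trans ?_
    rw [← lintegral_const_mul' _ _ ENNReal.ofReal_ne_top, ← lintegral_indicator hball]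
    refine lintegral_mono fun y => ?_
    by_cases hy : y ∈ Metric.ball x R
    · rw [Set.indicator_of_mem hy, enorm_mul, mul_comm]
      gcongr
      rw [← ofReal_norm]
      exact ENNReal.ofReal_le_ofReal (hK R hR _)
    · rw [Metric.mem_ball, dist_eq_norm, not_lt] at hy
      simp [radialBump_eq_zero N hR hy]
  · refine (enorm_integral_le_lintegral_enorm _).trans ?_
    rw [← lintegral_indicator hball]
    refine lintegral_mono fun y => ?_
    by_cases hy : y ∈ Metric.ball x R
    · rw [Set.indicator_of_mem hy, ← ofReal_norm, ← ofReal_norm,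
        ← ENNReal.ofReal_mul (norm_nonneg _)]
      refine ENNReal.ofReal_le_ofReal ((norm_inner_le_norm _ _).trans ?_)
      gcongr
      exact norm_radialField_sub_le N a R _
    · rw [Metric.mem_ball, dist_eq_norm, not_lt] at hy
      simp [radialField_sub_eq_zero N ha haR.le hy]

/-- The kernel `‖z‖^(1-N)` of the Riesz potential of order one. -/
noncomputable def rieszKernel (N : ℕ) (z : Euc N) : ENNReal :=
  ENNReal.ofReal (‖z‖ ^ (1 - (N : ℝ)))

lemma measurable_rieszKernel (N : ℕ) : Measurable (rieszKernel N) := by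
  unfold rieszKernel; fun_prop

lemma holderConjugate_natCast {N : ℕ} (hN : 2 ≤ N) :
    (N : ℝ).HolderConjugate ((N : ℝ) / ((N : ℝ) - 1)) := by
  have : (2 : ℝ) ≤ N := by exact_mod_cast hN
  exact Real.HolderConjugate.conjExponent (by linarith)

lemma lintegral_closedBall_rieszKernel_le {N : ℕ} (hN : 2 ≤ N) (x : Euc N) {r : ℝ} (hr : 0 < r) :
    ∫⁻ y in Metric.closedBall x r, rieszKernel N (y - x)
      ≤ ENNReal.ofReal (2 * sphereArea N * r) := by
  have h1 : (0 : ℝ) < (N : ℝ) + (1 - N) := by ring_nf; norm_num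
  have h2 := lintegral_ball_norm_rpow hN (b := 2 * r) (by positivity) h1
  have e : sphereArea N * ((2 * r) ^ ((N : ℝ) + (1 - N)) / ((N : ℝ) + (1 - N)))
      = 2 * sphereArea N * r := by
    rw [show (N : ℝ) + (1 - N) = 1 by ring]; simp; ring
  rw [← e, ← h2, ← lintegral_indicator measurableSet_closedBall,
    ← lintegral_indicator measurableSet_ball,
    ← lintegral_sub_right_eq_self (Set.indicator (Metric.ball 0 (2 * r)) _) x]
  refine lintegral_mono fun y => ?_
  by_cases hy : y ∈ Metric.closedBall x r
  · have hy' : y - x ∈ Metric.ball (0 : Euc N) (2 * r) := by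
      rw [Metric.mem_closedBall, dist_eq_norm] at hy
      rw [mem_ball_zero_iff]; linarith
    rw [Set.indicator_of_mem hy, Set.indicator_of_mem hy']
    rfl
  · simp [Set.indicator_of_notMem hy]

/-- Hölder bound of the Riesz potential over a shell, with the sharp logarithmic constant. -/
lemma lintegral_shell_rieszKernel_le {N : ℕ} (hN : 2 ≤ N) {g : Euc N → Euc N} (hg : Measurable g)
    (hg1 : ∫⁻ x, ‖g x‖ₑ ^ (N : ℝ) ≤ 1) (x : Euc N) {r R : ℝ} (hr : 0 < r) (hrR : r ≤ R) :
    ∫⁻ y in {y | r < ‖y - x‖ ∧ ‖y - x‖ < R}, ‖g y‖ₑ * rieszKernel N (y - x)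
      ≤ ENNReal.ofReal ((sphereArea N * Real.log (R / r)) ^ (((N : ℝ) - 1) / N)) := by
  have hN' : (2 : ℝ) ≤ N := by exact_mod_cast hN
  have hpq := holderConjugate_natCast hN
  have hmk : Measurable fun y => rieszKernel N (y - x) :=
    (measurable_rieszKernel N).comp (measurable_id.sub_const x)
  have hS : MeasurableSet {y : Euc N | r < ‖y - x‖ ∧ ‖y - x‖ < R} := by
    measurability
  have hS0 : MeasurableSet {y : Euc N | r < ‖y‖ ∧ ‖y‖ < R} := by
    measurability
  have h := ENNReal.lintegral_mul_le_Lp_mul_Lq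
    (volume.restrict {y : Euc N | r < ‖y - x‖ ∧ ‖y - x‖ < R}) hpq
    (f := fun y => ‖g y‖ₑ) (g := fun y => rieszKernel N (y - x))
    hg.enorm.aemeasurable hmk.aemeasurable
  refine h.trans ?_
  have h1 : (∫⁻ y in {y : Euc N | r < ‖y - x‖ ∧ ‖y - x‖ < R}, ‖g y‖ₑ ^ (N : ℝ)) ^ (1 / (N : ℝ))
      ≤ 1 := by
    refine ENNReal.rpow_le_one ((setLIntegral_le_lintegral _ _).trans hg1) (by positivity)
  have h2 : ∫⁻ y in {y : Euc N | r < ‖y - x‖ ∧ ‖y - x‖ < R},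
      rieszKernel N (y - x) ^ ((N : ℝ) / ((N : ℝ) - 1))
      = ENNReal.ofReal (sphereArea N * Real.log (R / r)) := by
    rw [← lintegral_shell_norm_rpow_neg hN hr hrR, ← lintegral_indicator hS,
      ← lintegral_indicator hS0,
      ← lintegral_sub_right_eq_self (Set.indicator {y : Euc N | r < ‖y‖ ∧ ‖y‖ < R} _) x]
    refine lintegral_congr fun y => ?_
    by_cases hy : r < ‖y - x‖ ∧ ‖y - x‖ < R
    · rw [Set.indicator_of_mem (by exact hy), Set.indicator_of_mem (by exact hy), rieszKernel,
        ENNReal.ofReal_rpow_of_nonneg (by positivity) hpq.symm.nonneg, ← Real.rpow_mul (norm_nonneg _)]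
      have : (N : ℝ) - 1 ≠ 0 := by linarith
      have e : (1 - (N : ℝ)) * (N / (N - 1)) = -N := by field_simp; ring
      rw [e]
    · rw [Set.indicator_of_notMem (by exact hy), Set.indicator_of_notMem (by exact hy)]
  have hlog : 0 ≤ sphereArea N * Real.log (R / r) :=
    mul_nonneg (sphereArea_pos hN).le (Real.log_nonneg ((one_le_div hr).2 hrR))
  calc _ ≤ 1 * (ENNReal.ofReal (sphereArea N * Real.log (R / r)))
        ^ (1 / ((N : ℝ) / ((N : ℝ) - 1))) := by
        gcongr
        · exact one_div_nonneg.2 hpq.symm.nonneg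
        · exact h2.le
    _ = _ := by
        rw [one_mul, one_div_div, ENNReal.ofReal_rpow_of_nonneg hlog
          (div_nonneg (by linarith) (by linarith))]

lemma rpow_lintegral_closedBall_rieszKernel_le {N : ℕ} (hN : 2 ≤ N) {g : Euc N → Euc N}
    (hg : Measurable g) (x : Euc N) {r : ℝ} (hr : 0 < r) :
    (∫⁻ y in Metric.closedBall x r, ‖g y‖ₑ * rieszKernel N (y - x)) ^ (N : ℝ)
      ≤ ENNReal.ofReal ((2 * sphereArea N * r) ^ ((N : ℝ) - 1))
        * ∫⁻ y in Metric.closedBall x r, ‖g y‖ₑ ^ (N : ℝ) * rieszKernel N (y - x) := by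
  have hN' : (2 : ℝ) ≤ N := by exact_mod_cast hN
  have hpq := holderConjugate_natCast hN
  have hω := sphereArea_pos hN
  have hmk : Measurable fun y => rieszKernel N (y - x) :=
    (measurable_rieszKernel N).comp (measurable_id.sub_const x)
  have h := ENNReal.lintegral_mul_le_Lp_mul_Lq (volume.restrict (Metric.closedBall x r)) hpq
    (f := fun y => ‖g y‖ₑ * rieszKernel N (y - x) ^ (1 / (N : ℝ)))
    (g := fun y => rieszKernel N (y - x) ^ (1 / ((N : ℝ) / ((N : ℝ) - 1))))
    (hg.enorm.mul (hmk.pow_const _)).aemeasurable (hmk.pow_const _).aemeasurable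
  have e1 : ∀ y, ((fun y => ‖g y‖ₑ * rieszKernel N (y - x) ^ (1 / (N : ℝ))) *
      fun y => rieszKernel N (y - x) ^ (1 / ((N : ℝ) / ((N : ℝ) - 1)))) y
      = ‖g y‖ₑ * rieszKernel N (y - x) := fun y => by
    simp only [Pi.mul_apply]
    rw [mul_assoc, ← ENNReal.rpow_add_of_nonneg _ _ (by positivity)
      (by have := hpq.symm.nonneg; positivity)]
    have : 1 / (N : ℝ) + 1 / ((N : ℝ) / ((N : ℝ) - 1)) = 1 := by
      rw [one_div, one_div]; exact hpq.inv_add_inv_eq_one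
    rw [this, ENNReal.rpow_one]
  have e2 : ∀ y, (‖g y‖ₑ * rieszKernel N (y - x) ^ (1 / (N : ℝ))) ^ (N : ℝ)
      = ‖g y‖ₑ ^ (N : ℝ) * rieszKernel N (y - x) := fun y => by
    rw [ENNReal.mul_rpow_of_nonneg _ _ (by positivity), ← ENNReal.rpow_mul,
      one_div_mul_cancel (by positivity), ENNReal.rpow_one]
  have e3 : ∀ y, (rieszKernel N (y - x) ^ (1 / ((N : ℝ) / ((N : ℝ) - 1))))
      ^ ((N : ℝ) / ((N : ℝ) - 1)) = rieszKernel N (y - x) := fun y => by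
    rw [← ENNReal.rpow_mul, one_div_mul_cancel hpq.symm.ne_zero, ENNReal.rpow_one]
  simp_rw [e1, e2, e3] at h
  calc _ ≤ ((∫⁻ y in Metric.closedBall x r, ‖g y‖ₑ ^ (N : ℝ) * rieszKernel N (y - x))
          ^ (1 / (N : ℝ)) * (∫⁻ y in Metric.closedBall x r, rieszKernel N (y - x))
          ^ (1 / ((N : ℝ) / ((N : ℝ) - 1)))) ^ (N : ℝ) := by gcongr
    _ = (∫⁻ y in Metric.closedBall x r, rieszKernel N (y - x)) ^ ((N : ℝ) - 1) *
        ∫⁻ y in Metric.closedBall x r, ‖g y‖ₑ ^ (N : ℝ) * rieszKernel N (y - x) := by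
        rw [ENNReal.mul_rpow_of_nonneg _ _ (by positivity), ← ENNReal.rpow_mul, ← ENNReal.rpow_mul,
          one_div_mul_cancel (by positivity), ENNReal.rpow_one, mul_comm]
        congr 2
        field_simp
    _ ≤ _ := by
        rw [← ENNReal.ofReal_rpow_of_nonneg (by positivity) (by linarith)]
        gcongr
        · linarith
        · exact lintegral_closedBall_rieszKernel_le hN x hr

/-- The radius `l^(1-t/N) (l + ‖x‖)^(t/N)` of the ball around `x` adapted to the weight
`‖x‖^(-t)` at scale `l`. -/
noncomputable def weightRadius (N : ℕ) (t l : ℝ) (x : Euc N) : ℝ :=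
  l ^ (1 - t / N) * (l + ‖x‖) ^ (t / N)

lemma weightRadius_pos (N : ℕ) (t : ℝ) {l : ℝ} (hl : 0 < l) (x : Euc N) :
    0 < weightRadius N t l x := by
  unfold weightRadius; positivity

lemma measurable_weightRadius (N : ℕ) (t l : ℝ) : Measurable (weightRadius N t l) := by
  unfold weightRadius; fun_prop

lemma weightRadius_pow {N : ℕ} (hN : 2 ≤ N) (t : ℝ) {l : ℝ} (hl : 0 < l) (x : Euc N) :
    weightRadius N t l x ^ N = l ^ ((N : ℝ) - t) * (l + ‖x‖) ^ t := by
  have hN' : (2 : ℝ) ≤ N := by exact_mod_cast hN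
  have hx : 0 ≤ l + ‖x‖ := by positivity
  rw [weightRadius, mul_pow, ← Real.rpow_natCast, ← Real.rpow_natCast, ← Real.rpow_mul hl.le,
    ← Real.rpow_mul hx]
  congr 2 <;> field_simp

lemma weightRadius_le {N : ℕ} {t : ℝ} (ht0 : 0 ≤ t) (htN : t < N) {l : ℝ} (hl : 0 < l)
    (x : Euc N) : weightRadius N t l x ≤ l + ‖x‖ := by
  have hN : (0 : ℝ) < N := ht0.trans_lt htN
  have h1 : t / N ≤ 1 := (div_le_one hN).2 htN.le
  have hx : 0 < l + ‖x‖ := by positivity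
  calc weightRadius N t l x ≤ (l + ‖x‖) ^ (1 - t / N) * (l + ‖x‖) ^ (t / N) := by
        unfold weightRadius
        gcongr
        linarith [norm_nonneg x]
    _ = l + ‖x‖ := by rw [← Real.rpow_add hx]; simp

lemma weightRadius_le_two_mul {N : ℕ} {t : ℝ} (ht0 : 0 ≤ t) (htN : t < N) {l : ℝ} (hl : 0 < l)
    {x y : Euc N} (h : l + ‖x‖ ≤ 2 * (l + ‖y‖)) :
    weightRadius N t l x ≤ 2 * weightRadius N t l y := by
  have hN : (0 : ℝ) < N := ht0.trans_lt htN
  have h1 : t / N ≤ 1 := (div_le_one hN).2 htN.le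
  have h2 : (2 : ℝ) ^ (t / N) ≤ 2 := by
    simpa using Real.rpow_le_rpow_of_exponent_le (x := 2) (by norm_num) h1
  calc weightRadius N t l x ≤ l ^ (1 - t / N) * (2 * (l + ‖y‖)) ^ (t / N) := by
        unfold weightRadius
        gcongr
    _ = 2 ^ (t / N) * weightRadius N t l y := by
        rw [Real.mul_rpow (by norm_num) (by positivity), weightRadius]; ring
    _ ≤ 2 * weightRadius N t l y := by
        gcongr; exact (weightRadius_pos N t hl y).le

lemma weightRadius_comparable {N : ℕ} {t : ℝ} (ht0 : 0 ≤ t) (htN : t < N) {l : ℝ} (hl : 0 < l)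
    {δ : ℝ} (hδ : δ ≤ 1 / 2) {x y : Euc N} (h : ‖y - x‖ ≤ δ * weightRadius N t l x) :
    weightRadius N t l x ≤ 2 * weightRadius N t l y ∧
      weightRadius N t l y ≤ 2 * weightRadius N t l x := by
  have h1 : ‖y - x‖ ≤ 1 / 2 * (l + ‖x‖) := by
    refine h.trans ?_
    have := weightRadius_le ht0 htN hl x
    have := weightRadius_pos N t hl x
    nlinarith
  have h2 : ‖x‖ ≤ ‖y‖ + ‖y - x‖ := by
    rw [norm_sub_rev]; linarith [norm_sub_norm_le x y]
  have h3 : ‖y‖ ≤ ‖x‖ + ‖y - x‖ := by linarith [norm_sub_norm_le y x]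
  have := norm_nonneg x
  exact ⟨weightRadius_le_two_mul ht0 htN hl (by linarith),
    weightRadius_le_two_mul ht0 htN hl (by linarith)⟩

lemma norm_rpow_neg_mul_weightRadius_le {N : ℕ} (hN : 2 ≤ N) {t : ℝ} (ht0 : 0 ≤ t) (htN : t < N)
    {l : ℝ} (hl : 0 < l) {δ : ℝ} (hδ0 : 0 < δ) (hδ : δ ≤ 1 / 2) {x y : Euc N}
    (hx : δ * l ≤ ‖x‖) (h : ‖y - x‖ ≤ δ * weightRadius N t l x) :
    ‖x‖ ^ (-t) * (2 * sphereArea N * (δ * weightRadius N t l x)) ^ ((N : ℝ) - 1)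
      ≤ (2 * sphereArea N) ^ ((N : ℝ) - 1) * 2 ^ (t + 1) * δ ^ ((N : ℝ) - 1 - t)
        * l ^ ((N : ℝ) - t) * (weightRadius N t l y)⁻¹ := by
  have hω := sphereArea_pos hN
  have hRx := weightRadius_pos N t hl x
  have hRy := weightRadius_pos N t hl y
  have hlx : 0 < l + ‖x‖ := by positivity
  have h1 : δ / 2 * (l + ‖x‖) ≤ ‖x‖ := by nlinarith [norm_nonneg x]
  have h2 : ‖x‖ ^ (-t) ≤ (δ / 2) ^ (-t) * (l + ‖x‖) ^ (-t) := by
    rw [← Real.mul_rpow (by positivity) hlx.le]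
    exact Real.rpow_le_rpow_of_nonpos (by positivity) h1 (by linarith)
  have h3 : (l + ‖x‖) ^ (-t) * weightRadius N t l x ^ ((N : ℝ) - 1)
      = l ^ ((N : ℝ) - t) * (weightRadius N t l x)⁻¹ := by
    rw [Real.rpow_sub_one hRx.ne', Real.rpow_natCast, weightRadius_pow hN t hl, Real.rpow_neg hlx.le]
    have := (Real.rpow_pos_of_pos hlx t).ne'
    field_simp
  have h4 : (weightRadius N t l x)⁻¹ ≤ 2 * (weightRadius N t l y)⁻¹ := by
    rw [inv_le_iff_one_le_mul₀ hRx]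
    have := (weightRadius_comparable ht0 htN hl hδ h).2
    rw [mul_assoc, mul_comm, mul_assoc, ← div_eq_inv_mul, one_le_div hRy]
    linarith
  have h5 : (δ / 2) ^ (-t) * δ ^ ((N : ℝ) - 1) = 2 ^ t * δ ^ ((N : ℝ) - 1 - t) := by
    rw [Real.div_rpow hδ0.le (by norm_num), Real.rpow_neg (by norm_num : (0 : ℝ) ≤ 2),
      div_inv_eq_mul, mul_comm _ ((2 : ℝ) ^ t), mul_assoc, ← Real.rpow_add hδ0]
    congr 2; ring
  calc _ = ‖x‖ ^ (-t) * ((2 * sphereArea N) ^ ((N : ℝ) - 1) * (δ ^ ((N : ℝ) - 1)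
        * weightRadius N t l x ^ ((N : ℝ) - 1))) := by
        rw [Real.mul_rpow (by positivity) (by positivity), Real.mul_rpow hδ0.le hRx.le]
    _ ≤ ((δ / 2) ^ (-t) * (l + ‖x‖) ^ (-t)) * ((2 * sphereArea N) ^ ((N : ℝ) - 1) *
        (δ ^ ((N : ℝ) - 1) * weightRadius N t l x ^ ((N : ℝ) - 1))) := by gcongr
    _ = (2 * sphereArea N) ^ ((N : ℝ) - 1) * ((δ / 2) ^ (-t) * δ ^ ((N : ℝ) - 1)) *
        ((l + ‖x‖) ^ (-t) * weightRadius N t l x ^ ((N : ℝ) - 1)) := by ring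
    _ = (2 * sphereArea N) ^ ((N : ℝ) - 1) * (2 ^ t * δ ^ ((N : ℝ) - 1 - t)) *
        (l ^ ((N : ℝ) - t) * (weightRadius N t l x)⁻¹) := by rw [h3, h5]
    _ ≤ (2 * sphereArea N) ^ ((N : ℝ) - 1) * (2 ^ t * δ ^ ((N : ℝ) - 1 - t)) *
        (l ^ ((N : ℝ) - t) * (2 * (weightRadius N t l y)⁻¹)) := by gcongr
    _ = _ := by rw [Real.rpow_add_one (by norm_num : (2 : ℝ) ≠ 0)]; ring

/-- The part of the Riesz potential of `‖g‖` at `x` coming from the ball of radius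
`δ * weightRadius N t l x`. -/
noncomputable def nearPotential (N : ℕ) (t l δ : ℝ) (g : Euc N → Euc N) (x : Euc N) : ENNReal :=
  ∫⁻ y in Metric.closedBall x (δ * weightRadius N t l x), ‖g y‖ₑ * rieszKernel N (y - x)

lemma measurable_nearPotential (N : ℕ) (t l δ : ℝ) {g : Euc N → Euc N} (hg : Measurable g) :
    Measurable (nearPotential N t l δ g) := by
  have hS : MeasurableSet {p : Euc N × Euc N | ‖p.2 - p.1‖ ≤ δ * weightRadius N t l p.1} :=
    measurableSet_le (measurable_snd.sub measurable_fst).norm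
      (((measurable_weightRadius N t l).comp measurable_fst).const_mul δ)
  have hm : Measurable fun p : Euc N × Euc N => ‖g p.2‖ₑ * rieszKernel N (p.2 - p.1) :=
    (hg.comp measurable_snd).enorm.mul
      ((measurable_rieszKernel N).comp (measurable_snd.sub measurable_fst))
  have := (hm.indicator hS).lintegral_prod_right' (ν := volume)
  convert this using 2 with x
  rw [nearPotential, ← lintegral_indicator measurableSet_closedBall]
  refine lintegral_congr fun y => ?_
  by_cases h : ‖y - x‖ ≤ δ * weightRadius N t l x
  · rw [Set.indicator_of_mem (by rwa [Metric.mem_closedBall, dist_eq_norm]),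
      Set.indicator_of_mem (by exact h)]
  · rw [Set.indicator_of_notMem (by rwa [Metric.mem_closedBall, dist_eq_norm]),
      Set.indicator_of_notMem (by exact h)]

lemma lintegral_nearPotential_rpow_le {N : ℕ} (hN : 2 ≤ N) {t : ℝ} (ht0 : 0 ≤ t) (htN : t < N) :
    ∃ B : ℝ, 0 ≤ B ∧ ∀ g : Euc N → Euc N, Measurable g → ∫⁻ x, ‖g x‖ₑ ^ (N : ℝ) ≤ 1 →
      ∀ l δ : ℝ, 0 < l → 0 < δ → δ ≤ 1 / 2 →
        ∫⁻ x in {x : Euc N | δ * l ≤ ‖x‖},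
          ENNReal.ofReal (‖x‖ ^ (-t)) * nearPotential N t l δ g x ^ (N : ℝ)
        ≤ ENNReal.ofReal (B * (δ ^ ((N : ℝ) - t) * l ^ ((N : ℝ) - t))) := by
  have hω := sphereArea_pos hN
  set A : ℝ := (2 * sphereArea N) ^ ((N : ℝ) - 1) * 2 ^ (t + 1) with hA
  have hA0 : 0 ≤ A := by positivity
  refine ⟨A * (4 * sphereArea N), by positivity, fun g hg hg1 l δ hl hδ0 hδ => ?_⟩
  set R := weightRadius N t l with hR
  have hRpos : ∀ x, 0 < R x := weightRadius_pos N t hl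
  have hRm : Measurable R := measurable_weightRadius N t l
  set A' : ℝ := A * δ ^ ((N : ℝ) - 1 - t) * l ^ ((N : ℝ) - t) with hA'
  have hA'0 : 0 ≤ A' := by positivity
  set S : Set (Euc N) := {x | δ * l ≤ ‖x‖} with hS
  have hSm : MeasurableSet S := measurableSet_le measurable_const measurable_norm
  set T : Set (Euc N × Euc N) := {p | ‖p.2 - p.1‖ ≤ 2 * δ * R p.2} with hT
  have hTm : MeasurableSet T :=
    measurableSet_le (measurable_snd.sub measurable_fst).norm
      ((hRm.comp measurable_snd).const_mul (2 * δ))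
  set G : Euc N × Euc N → ENNReal := T.indicator fun p =>
    ENNReal.ofReal (A' * (R p.2)⁻¹) * (‖g p.2‖ₑ ^ (N : ℝ) * rieszKernel N (p.2 - p.1)) with hG
  have hGm : Measurable G := by
    refine Measurable.indicator ?_ hTm
    refine (((hRm.comp measurable_snd).inv.const_mul A').ennreal_ofReal).mul ?_
    exact ((hg.comp measurable_snd).enorm.pow_const _).mul
      ((measurable_rieszKernel N).comp (measurable_snd.sub measurable_fst))
  have hle : ∫⁻ x in S, ENNReal.ofReal (‖x‖ ^ (-t)) * nearPotential N t l δ g x ^ (N : ℝ)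
      ≤ ∫⁻ x, ∫⁻ y, G (x, y) := by
    rw [← lintegral_indicator hSm]
    refine lintegral_mono fun x => ?_
    by_cases hx : x ∈ S
    swap
    · rw [Set.indicator_of_notMem hx]; exact zero_le
    rw [Set.indicator_of_mem hx]
    have hr : 0 < δ * R x := mul_pos hδ0 (hRpos x)
    calc _ ≤ ENNReal.ofReal (‖x‖ ^ (-t)) *
          (ENNReal.ofReal ((2 * sphereArea N * (δ * R x)) ^ ((N : ℝ) - 1))
            * ∫⁻ y in Metric.closedBall x (δ * R x), ‖g y‖ₑ ^ (N : ℝ) * rieszKernel N (y - x)) := by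
          gcongr
          exact rpow_lintegral_closedBall_rieszKernel_le hN hg x hr
      _ = ∫⁻ y, (Metric.closedBall x (δ * R x)).indicator (fun y =>
          ENNReal.ofReal (‖x‖ ^ (-t) * (2 * sphereArea N * (δ * R x)) ^ ((N : ℝ) - 1))
            * (‖g y‖ₑ ^ (N : ℝ) * rieszKernel N (y - x))) y := by
          rw [← mul_assoc, ← ENNReal.ofReal_mul (by positivity),
            lintegral_indicator measurableSet_closedBall,
            lintegral_const_mul' _ _ ENNReal.ofReal_ne_top]
      _ ≤ ∫⁻ y, G (x, y) := by
          refine lintegral_mono fun y => ?_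
          by_cases hy : y ∈ Metric.closedBall x (δ * R x)
          swap
          · simp only [Set.indicator_of_notMem hy]; exact zero_le
          have hy' : ‖y - x‖ ≤ δ * R x := by rwa [Metric.mem_closedBall, dist_eq_norm] at hy
          have hcomp := (weightRadius_comparable ht0 htN hl hδ hy').1
          have hxy : (x, y) ∈ T := by
            change ‖y - x‖ ≤ 2 * δ * R y
            refine hy'.trans ?_
            nlinarith
          rw [Set.indicator_of_mem hy, hG, Set.indicator_of_mem hxy]
          refine mul_le_mul' (ENNReal.ofReal_le_ofReal ?_) le_rfl
          exact norm_rpow_neg_mul_weightRadius_le hN ht0 htN hl hδ0 hδ hx hy'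
  refine hle.trans ?_
  rw [lintegral_lintegral_swap (f := fun x y => G (x, y)) hGm.aemeasurable]
  have hin : ∀ y, ∫⁻ x, G (x, y) ≤ ENNReal.ofReal (A' * (4 * sphereArea N * δ))
      * ‖g y‖ₑ ^ (N : ℝ) := fun y => by
    have hr : 0 < 2 * δ * R y := mul_pos (by positivity) (hRpos y)
    have e : ∀ x, G (x, y) = (Metric.closedBall y (2 * δ * R y)).indicator (fun x =>
        (ENNReal.ofReal (A' * (R y)⁻¹) * ‖g y‖ₑ ^ (N : ℝ)) * rieszKernel N (x - y)) x := fun x => by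
      have hk : rieszKernel N (y - x) = rieszKernel N (x - y) := by
        rw [rieszKernel, rieszKernel, norm_sub_rev]
      by_cases hx : x ∈ Metric.closedBall y (2 * δ * R y)
      · have hxT : (x, y) ∈ T := by
          change ‖y - x‖ ≤ 2 * δ * R y
          rwa [← dist_eq_norm, ← Metric.mem_closedBall']
        rw [Set.indicator_of_mem hx, hG, Set.indicator_of_mem hxT]
        simp only [hk, mul_assoc]
      · have hxT : (x, y) ∉ T := by
          change ¬ ‖y - x‖ ≤ 2 * δ * R y
          rwa [← dist_eq_norm, ← Metric.mem_closedBall']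
        rw [Set.indicator_of_notMem hx, hG, Set.indicator_of_notMem hxT]
    simp_rw [e]
    rw [lintegral_indicator measurableSet_closedBall, lintegral_const_mul (f := fun x => rieszKernel N (x - y)) _
      ((measurable_rieszKernel N).comp (measurable_id.sub_const y))]
    calc _ ≤ ENNReal.ofReal (A' * (R y)⁻¹) * ‖g y‖ₑ ^ (N : ℝ)
          * ENNReal.ofReal (2 * sphereArea N * (2 * δ * R y)) := by
          gcongr
          exact lintegral_closedBall_rieszKernel_le hN y hr
      _ = ENNReal.ofReal (A' * (R y)⁻¹ * (2 * sphereArea N * (2 * δ * R y))) * ‖g y‖ₑ ^ (N : ℝ) := by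
          rw [ENNReal.ofReal_mul (p := A' * (R y)⁻¹) (mul_nonneg hA'0 (inv_nonneg.2 (hRpos y).le))]
          ring
      _ = _ := by
          congr 2
          have := (hRpos y).ne'
          field_simp
          ring
  calc ∫⁻ y, ∫⁻ x, G (x, y)
      ≤ ∫⁻ y, ENNReal.ofReal (A' * (4 * sphereArea N * δ)) * ‖g y‖ₑ ^ (N : ℝ) := lintegral_mono hin
    _ = ENNReal.ofReal (A' * (4 * sphereArea N * δ)) * ∫⁻ y, ‖g y‖ₑ ^ (N : ℝ) :=
        lintegral_const_mul' _ _ ENNReal.ofReal_ne_top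
    _ ≤ ENNReal.ofReal (A' * (4 * sphereArea N * δ)) * 1 := by gcongr
    _ = _ := by
        rw [mul_one]
        congr 1
        have : δ ^ ((N : ℝ) - t) = δ ^ ((N : ℝ) - 1 - t) * δ := by
          rw [← Real.rpow_add_one hδ0.ne']; congr 1; ring
        rw [this, hA']
        ring

/-- Weighted measure of the superlevel sets of the near part of the Riesz potential. -/
lemma lintegral_nearPotential_ge_le {N : ℕ} (hN : 2 ≤ N) {t : ℝ} (ht0 : 0 ≤ t) (htN : t < N)
    {c : ℝ} (hc : 0 < c) :
    ∃ D : ℝ, 0 ≤ D ∧ ∀ g : Euc N → Euc N, Measurable g → ∫⁻ x, ‖g x‖ₑ ^ (N : ℝ) ≤ 1 →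
      ∀ l δ : ℝ, 0 < l → 0 < δ → δ ≤ 1 / 2 →
        ∫⁻ x in {x : Euc N | ENNReal.ofReal c ≤ nearPotential N t l δ g x},
          ENNReal.ofReal (‖x‖ ^ (-t))
        ≤ ENNReal.ofReal (D * (δ ^ ((N : ℝ) - t) * l ^ ((N : ℝ) - t))) := by
  obtain ⟨B, hB0, hB⟩ := lintegral_nearPotential_rpow_le hN ht0 htN
  have hω := sphereArea_pos hN
  have hNt : 0 < (N : ℝ) - t := sub_pos.2 htN
  refine ⟨sphereArea N / (N - t) + (c ^ (N : ℝ))⁻¹ * B, by positivity,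
    fun g hg hg1 l δ hl hδ0 hδ => ?_⟩
  set S : Set (Euc N) := {x | δ * l ≤ ‖x‖} with hS
  set Q : Set (Euc N) := {x | ENNReal.ofReal c ≤ nearPotential N t l δ g x} with hQ
  have hSm : MeasurableSet S := measurableSet_le measurable_const measurable_norm
  have hQm : MeasurableSet Q :=
    measurableSet_le measurable_const (measurable_nearPotential N t l δ hg)
  have hsub : Q ⊆ Metric.ball 0 (δ * l) ∪ Q ∩ S := fun x hx => by
    rcases lt_or_ge ‖x‖ (δ * l) with h | h
    · exact Or.inl (by simpa using h)
    · exact Or.inr ⟨hx, h⟩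
  have h1 : ∫⁻ x in Metric.ball (0 : Euc N) (δ * l), ENNReal.ofReal (‖x‖ ^ (-t))
      = ENNReal.ofReal (sphereArea N / (N - t) * (δ ^ ((N : ℝ) - t) * l ^ ((N : ℝ) - t))) := by
    rw [lintegral_ball_norm_rpow hN (by positivity) (by linarith), ← sub_eq_add_neg,
      Real.mul_rpow hδ0.le hl.le]
    congr 1; ring
  have hcN : ENNReal.ofReal (c ^ (N : ℝ)) = ENNReal.ofReal c ^ (N : ℝ) :=
    (ENNReal.ofReal_rpow_of_pos hc).symm
  have h2 : ∫⁻ x in Q ∩ S, ENNReal.ofReal (‖x‖ ^ (-t)) ≤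
      ENNReal.ofReal ((c ^ (N : ℝ))⁻¹ * B * (δ ^ ((N : ℝ) - t) * l ^ ((N : ℝ) - t))) := by
    calc _ ≤ ∫⁻ x in Q ∩ S, ENNReal.ofReal ((c ^ (N : ℝ))⁻¹) *
          (ENNReal.ofReal (‖x‖ ^ (-t)) * nearPotential N t l δ g x ^ (N : ℝ)) := by
          refine setLIntegral_mono' (hQm.inter hSm) fun x hx => ?_
          have hle : ENNReal.ofReal (c ^ (N : ℝ)) ≤ nearPotential N t l δ g x ^ (N : ℝ) := by
            rw [hcN]
            exact ENNReal.rpow_le_rpow hx.1 (by positivity)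
          calc ENNReal.ofReal (‖x‖ ^ (-t))
              = ENNReal.ofReal ((c ^ (N : ℝ))⁻¹) *
                (ENNReal.ofReal (‖x‖ ^ (-t)) * ENNReal.ofReal (c ^ (N : ℝ))) := by
                rw [← ENNReal.ofReal_mul (by positivity), ← ENNReal.ofReal_mul (by positivity)]
                congr 1; field_simp
            _ ≤ _ := by gcongr
      _ = ENNReal.ofReal ((c ^ (N : ℝ))⁻¹) * ∫⁻ x in Q ∩ S,
          (ENNReal.ofReal (‖x‖ ^ (-t)) * nearPotential N t l δ g x ^ (N : ℝ)) :=
          lintegral_const_mul' _ _ ENNReal.ofReal_ne_top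
      _ ≤ ENNReal.ofReal ((c ^ (N : ℝ))⁻¹) *
          ENNReal.ofReal (B * (δ ^ ((N : ℝ) - t) * l ^ ((N : ℝ) - t))) := by
          gcongr
          exact (lintegral_mono_set Set.inter_subset_right).trans (hB g hg hg1 l δ hl hδ0 hδ)
      _ = _ := by rw [← ENNReal.ofReal_mul (by positivity), mul_assoc]
  calc _ ≤ _ := lintegral_mono_set hsub
    _ ≤ _ := lintegral_union_le _ _ _
    _ ≤ _ := add_le_add h1.le h2
    _ = _ := by
        rw [← ENNReal.ofReal_add (by positivity) (by positivity)]
        congr 1; ring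

/-- The local means of `u` at scale `weightRadius` are bounded when the weighted `L^N` norm of `u`
is bounded by the scale. -/
lemma mean_weightRadius_le {N : ℕ} (hN : 2 ≤ N) {t : ℝ} (ht0 : 0 ≤ t) (htN : t < N) {K : ℝ}
    (hK : 0 ≤ K) :
    ∃ M : ℝ, 0 ≤ M ∧ ∀ u : Euc N → ℝ, Measurable u → ∀ l : ℝ, 0 < l →
      ∫⁻ x, ENNReal.ofReal (|u x| ^ (N : ℝ) * ‖x‖ ^ (-t)) ≤ ENNReal.ofReal (l ^ ((N : ℝ) - t)) →
      ∀ x, ENNReal.ofReal (K * (weightRadius N t l x ^ N)⁻¹)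
        * (∫⁻ y in Metric.ball x (weightRadius N t l x), ‖u y‖ₑ) ≤ ENNReal.ofReal M := by
  have hN' : (2 : ℝ) ≤ N := by exact_mod_cast hN
  have hpq := holderConjugate_natCast hN
  have : Nonempty (Fin N) := ⟨⟨0, by omega⟩⟩
  set v : ℝ := volume.real (Metric.ball (0 : Euc N) 1) with hv
  have hv0 : 0 ≤ v := measureReal_nonneg
  set q : ℝ := (N : ℝ) / ((N : ℝ) - 1) with hq
  refine ⟨K * ((2 ^ t) ^ (1 / (N : ℝ)) * v ^ (1 / q)), by positivity, fun u hu l hl hW x => ?_⟩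
  set R := weightRadius N t l x with hR
  have hRpos : 0 < R := weightRadius_pos N t hl x
  have hRle : R ≤ l + ‖x‖ := weightRadius_le ht0 htN hl x
  have hRN : R ^ N = l ^ ((N : ℝ) - t) * (l + ‖x‖) ^ t := weightRadius_pow hN t hl x
  have hvol : volume (Metric.ball x R) = ENNReal.ofReal (R ^ N * v) := by
    rw [Measure.addHaar_ball _ _ hRpos.le, finrank_euclideanSpace, Fintype.card_fin,
      ENNReal.ofReal_mul (by positivity), hv, ofReal_measureReal measure_ball_lt_top.ne]
  have h0 : ∀ᵐ y : Euc N, y ≠ 0 := by simp [ae_iff, measure_singleton]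
  have hpow : ∫⁻ y in Metric.ball x R, ‖u y‖ₑ ^ (N : ℝ) ≤ ENNReal.ofReal (2 ^ t * R ^ N) := by
    calc _ ≤ ∫⁻ y in Metric.ball x R, ENNReal.ofReal ((2 * (l + ‖x‖)) ^ t) *
          ENNReal.ofReal (|u y| ^ (N : ℝ) * ‖y‖ ^ (-t)) := by
          refine setLIntegral_mono_ae' measurableSet_ball ?_
          filter_upwards [h0] with y hy hyB
          rw [← ofReal_norm, ENNReal.ofReal_rpow_of_nonneg (norm_nonneg _) (by positivity),
            ← ENNReal.ofReal_mul (by positivity), Real.norm_eq_abs]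
          refine ENNReal.ofReal_le_ofReal ?_
          have hy0 : 0 < ‖y‖ := norm_pos_iff.2 hy
          have hyle : ‖y‖ ≤ 2 * (l + ‖x‖) := by
            rw [Metric.mem_ball, dist_eq_norm] at hyB
            have := norm_sub_norm_le y x
            linarith
          have h1 : ‖y‖ ^ t ≤ (2 * (l + ‖x‖)) ^ t := Real.rpow_le_rpow hy0.le hyle ht0
          calc |u y| ^ (N : ℝ) = ‖y‖ ^ t * (|u y| ^ (N : ℝ) * ‖y‖ ^ (-t)) := by
                rw [Real.rpow_neg hy0.le]
                have := (Real.rpow_pos_of_pos hy0 t).ne'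
                field_simp
            _ ≤ _ := by gcongr
      _ = ENNReal.ofReal ((2 * (l + ‖x‖)) ^ t) *
          ∫⁻ y in Metric.ball x R, ENNReal.ofReal (|u y| ^ (N : ℝ) * ‖y‖ ^ (-t)) :=
          lintegral_const_mul' _ _ ENNReal.ofReal_ne_top
      _ ≤ ENNReal.ofReal ((2 * (l + ‖x‖)) ^ t) * ENNReal.ofReal (l ^ ((N : ℝ) - t)) := by
          gcongr
          exact (setLIntegral_le_lintegral _ _).trans hW
      _ = _ := by
          rw [← ENNReal.ofReal_mul (by positivity), hRN,
            Real.mul_rpow (by norm_num) (by positivity)]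
          congr 1; ring
  have hmain : ∫⁻ y in Metric.ball x R, ‖u y‖ₑ
      ≤ ENNReal.ofReal ((2 ^ t * R ^ N) ^ (1 / (N : ℝ)) * (R ^ N * v) ^ (1 / q)) := by
    have h := ENNReal.lintegral_mul_le_Lp_mul_Lq (volume.restrict (Metric.ball x R)) hpq
      (f := fun y => ‖u y‖ₑ) (g := fun _ => 1) hu.enorm.aemeasurable aemeasurable_const
    simp only [Pi.mul_apply, mul_one, ENNReal.one_rpow, lintegral_const, one_mul,
      Measure.restrict_apply_univ, hvol] at h
    refine h.trans ?_
    have hq0 : 0 ≤ 1 / q := one_div_nonneg.2 hpq.symm.nonneg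
    rw [ENNReal.ofReal_mul (p := (2 ^ t * R ^ N) ^ (1 / (N : ℝ))) (by positivity),
      ← ENNReal.ofReal_rpow_of_nonneg (p := 1 / (N : ℝ)) (by positivity) (by positivity),
      ← ENNReal.ofReal_rpow_of_nonneg (p := 1 / q) (by positivity) hq0]
    gcongr
  calc _ ≤ ENNReal.ofReal (K * (R ^ N)⁻¹) *
        ENNReal.ofReal ((2 ^ t * R ^ N) ^ (1 / (N : ℝ)) * (R ^ N * v) ^ (1 / q)) := by gcongr
    _ = _ := by
        rw [← ENNReal.ofReal_mul (by positivity)]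
        congr 1
        have hX : 0 < R ^ N := by positivity
        have hXX : (R ^ N) ^ (1 / (N : ℝ)) * (R ^ N) ^ (1 / q) = R ^ N := by
          rw [← Real.rpow_add hX, one_div, one_div, hpq.inv_add_inv_eq_one, Real.rpow_one]
        rw [Real.mul_rpow (by positivity) hX.le, Real.mul_rpow hX.le hv0]
        calc _ = K * (R ^ N)⁻¹ * ((R ^ N) ^ (1 / (N : ℝ)) * (R ^ N) ^ (1 / q)) *
              ((2 ^ t) ^ (1 / (N : ℝ)) * v ^ (1 / q)) := by ring
          _ = _ := by rw [hXX]; field_simp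

lemma HasWeakGradient.congr_ae {N : ℕ} {u v : Euc N → ℝ} {g h : Euc N → Euc N}
    (hug : HasWeakGradient u g) (huv : u =ᵐ[volume] v) (hgh : g =ᵐ[volume] h) :
    HasWeakGradient v h := by
  refine ⟨hug.1.congr huv, hug.2.1.congr hgh, fun φ hφ hφc i => ?_⟩
  have h₁ : ∫ x, v x * fderiv ℝ φ x (EuclideanSpace.single i 1)
      = ∫ x, u x * fderiv ℝ φ x (EuclideanSpace.single i 1) :=
    integral_congr_ae (huv.mono fun x hx => by simp only [hx])
  have h₂ : ∫ x, h x i * φ x = ∫ x, g x i * φ x :=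
    integral_congr_ae (hgh.mono fun x hx => by simp only [hx])
  rw [h₁, h₂, hug.2.2 φ hφ hφc i]

lemma PhiN_le_exp (N : ℕ) {τ : ℝ} (hτ : 0 ≤ τ) : PhiN N τ ≤ Real.exp τ := by
  have h := (Real.summable_pow_div_factorial τ).sum_add_tsum_nat_add (N - 1)
  rw [Real.exp_eq_exp_ℝ, congrFun NormedSpace.exp_eq_tsum_div τ, ← h, PhiN]
  exact le_add_of_nonneg_left (Finset.sum_nonneg fun i _ => by positivity)

lemma PhiN_le_pow_mul_exp (N : ℕ) {τ : ℝ} (hτ : 0 ≤ τ) :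
    PhiN N τ ≤ τ ^ (N - 1) * Real.exp τ := by
  have h := Real.summable_pow_div_factorial τ
  rw [Real.exp_eq_exp_ℝ, congrFun NormedSpace.exp_eq_tsum_div τ, ← tsum_mul_left, PhiN]
  refine ((summable_nat_add_iff (N - 1)).2 h).tsum_le_tsum (fun j => ?_) (h.mul_left _)
  rw [pow_add, mul_comm (τ ^ j), mul_div_assoc]
  gcongr
  exact Nat.le_add_right _ _

lemma PhiN_zero {N : ℕ} (hN : 2 ≤ N) : PhiN N 0 = 0 := by
  have : N - 1 ≠ 0 := by omega
  simp [PhiN, this]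

/-- Exponential decay of the weighted measure of the superlevel sets of `|u| ^ (N / (N - 1))`. -/
lemma lintegral_superlevel_le {N : ℕ} (hN : 2 ≤ N) {t : ℝ} (ht0 : 0 ≤ t) (htN : t < N) {κ : ℝ}
    (hκ0 : 0 < κ) (hκ : κ < sphereArea N ^ (1 / ((N : ℝ) - 1))) :
    ∃ D : ℝ, 0 ≤ D ∧ ∃ k₀ : ℕ, ∀ (u : Euc N → ℝ) (g : Euc N → Euc N), Measurable u → Measurable g →
      HasWeakGradient u g → ∫⁻ x, ‖g x‖ₑ ^ (N : ℝ) ≤ 1 → ∀ l : ℝ, 0 < l →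
      ∫⁻ x, ENNReal.ofReal (|u x| ^ (N : ℝ) * ‖x‖ ^ (-t)) ≤ ENNReal.ofReal (l ^ ((N : ℝ) - t)) →
      ∀ k : ℕ, k₀ ≤ k →
        ∫⁻ x in {x | (k : ℝ) < |u x| ^ ((N : ℝ) / ((N : ℝ) - 1))}, ENNReal.ofReal (‖x‖ ^ (-t))
        ≤ ENNReal.ofReal (D * (Real.exp (-κ * k) ^ ((N : ℝ) - t) * l ^ ((N : ℝ) - t))) := by
  have hω := sphereArea_pos hN
  have hN' : (2 : ℝ) ≤ N := by exact_mod_cast hN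
  have hN1 : 0 < (N : ℝ) - 1 := by linarith
  obtain ⟨K, hK0, hK⟩ := HasWeakGradient.ae_enorm_le hN
  obtain ⟨M, hM0, hM⟩ := mean_weightRadius_le hN ht0 htN hK0
  obtain ⟨D, hD0, hD⟩ := lintegral_nearPotential_ge_le hN ht0 htN one_pos
  set p : ℝ := ((N : ℝ) - 1) / N with hp
  have hp0 : 0 < p := by positivity
  set η : ℝ := sphereArea N - (sphereArea N * κ) ^ p with hη
  have hη0 : 0 < η := by
    rw [hη, sub_pos]
    calc (sphereArea N * κ) ^ p
        < (sphereArea N * sphereArea N ^ (1 / ((N : ℝ) - 1))) ^ p := by gcongr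
      _ = sphereArea N := by
        rw [← Real.rpow_one_add' hω.le (by positivity), ← Real.rpow_mul hω.le]
        convert Real.rpow_one _ using 2
        rw [hp]; field_simp; ring
  have hev : ∀ᶠ k : ℕ in Filter.atTop, M + 1 ≤ η * (k : ℝ) ^ p ∧ Real.exp (-κ * k) ≤ 1 / 2 := by
    refine Filter.Eventually.and ?_ ?_
    · exact (((tendsto_rpow_atTop hp0).comp tendsto_natCast_atTop_atTop).const_mul_atTop
        hη0).eventually_ge_atTop _
    · have h : Filter.Tendsto (fun k : ℕ => Real.exp (-κ * k)) Filter.atTop (nhds 0) :=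
        Real.tendsto_exp_atBot.comp
          (tendsto_natCast_atTop_atTop.const_mul_atTop_of_neg (neg_lt_zero.2 hκ0))
      exact h.eventually_le_const (by norm_num)
  obtain ⟨k₀, hk₀⟩ := Filter.eventually_atTop.1 hev
  refine ⟨D, hD0, k₀, fun u g hu hg hug hg1 l hl hW k hk => ?_⟩
  obtain ⟨hkM, hkδ⟩ := hk₀ k hk
  set δ := Real.exp (-κ * k) with hδ
  have hδ0 : 0 < δ := Real.exp_pos _
  refine le_trans ?_ (hD g hg hg1 l δ hl hδ0 hkδ)
  refine lintegral_mono_set' ?_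
  filter_upwards [hK u g hug] with x hx hxk
  change (k : ℝ) < |u x| ^ ((N : ℝ) / ((N : ℝ) - 1)) at hxk
  change ENNReal.ofReal 1 ≤ nearPotential N t l δ g x
  set R := weightRadius N t l x with hR
  have hR0 : 0 < R := weightRadius_pos N t hl x
  have hxk' : (k : ℝ) ^ p < |u x| := by
    by_contra! h
    refine hxk.not_ge ((Real.rpow_le_rpow (abs_nonneg _) h (by positivity)).trans_eq ?_)
    rw [← Real.rpow_mul (by positivity)]
    convert Real.rpow_one _ using 2
    rw [hp]; field_simp
  by_contra! hlt
  have hshell := lintegral_shell_rieszKernel_le hN hg hg1 x (r := δ * R) (R := R)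
    (by positivity) (by nlinarith)
  have hlog : Real.log (R / (δ * R)) = κ * k := by
    rw [div_mul_cancel_right₀ hR0.ne', Real.log_inv, hδ, Real.log_exp]; ring
  rw [hlog, ← mul_assoc, Real.mul_rpow (by positivity) (by positivity)] at hshell
  have hsub : Metric.ball x R ⊆
      Metric.closedBall x (δ * R) ∪ {y | δ * R < ‖y - x‖ ∧ ‖y - x‖ < R} := fun y hy => by
    rw [Metric.mem_ball, dist_eq_norm] at hy
    rcases le_or_gt ‖y - x‖ (δ * R) with h | h
    · exact Or.inl (by rwa [Metric.mem_closedBall, dist_eq_norm])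
    · exact Or.inr ⟨h, hy⟩
  have hball : ∫⁻ y in Metric.ball x R, ‖g y‖ₑ * rieszKernel N (y - x)
      ≤ ENNReal.ofReal 1 + ENNReal.ofReal ((sphereArea N * κ) ^ p * (k : ℝ) ^ p) :=
    (lintegral_mono_set hsub).trans <| (lintegral_union_le _ _ _).trans <|
      add_le_add hlt.le hshell
  have hfin := (hx R hR0).trans (add_le_add (hM u hu l hl hW x) hball)
  rw [← ENNReal.ofReal_add zero_le_one (by positivity), ← ENNReal.ofReal_add hM0 (by positivity),
    ← ofReal_norm, ← ENNReal.ofReal_mul (norm_nonneg _), ENNReal.ofReal_le_ofReal_iff (by positivity),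
    Real.norm_eq_abs] at hfin
  have := mul_lt_mul_of_pos_right hxk' hω
  rw [hη] at hkM
  linarith

lemma rpow_conjExponent_pow {N : ℕ} (hN : 2 ≤ N) {a : ℝ} (ha : 0 ≤ a) :
    (a ^ ((N : ℝ) / ((N : ℝ) - 1))) ^ (N - 1) = a ^ (N : ℝ) := by
  have hN' : (2 : ℝ) ≤ N := by exact_mod_cast hN
  have hN1 : (N : ℝ) - 1 ≠ 0 := by linarith
  rw [← Real.rpow_natCast, ← Real.rpow_mul ha, Nat.cast_sub (by omega), Nat.cast_one,
    div_mul_cancel₀ _ hN1]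

/-- Pointwise bound of `PhiN N (α * τ)` by a multiple of `τ ^ (N - 1)` and a sum over the layers
`{k < τ}`. -/
lemma ofReal_PhiN_mul_le (N : ℕ) {α τ w : ℝ} (hα : 0 < α) (hτ : 0 ≤ τ) (hw : 0 ≤ w) (k₀ : ℕ) :
    ENNReal.ofReal (PhiN N (α * τ) * w) ≤
      ENNReal.ofReal (α ^ (N - 1) * Real.exp (α * k₀)) * ENNReal.ofReal (τ ^ (N - 1) * w)
      + ∑' j : ℕ, ENNReal.ofReal (Real.exp (α * ((j + k₀ : ℕ) + 1))) *
        {s : ℝ | ((j + k₀ : ℕ) : ℝ) < s}.indicator (fun _ => ENNReal.ofReal w) τ := by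
  rcases le_or_gt τ k₀ with h | h
  · refine le_add_right ?_
    rw [← ENNReal.ofReal_mul (by positivity)]
    refine ENNReal.ofReal_le_ofReal ?_
    calc PhiN N (α * τ) * w ≤ (α * τ) ^ (N - 1) * Real.exp (α * τ) * w := by
          gcongr; exact PhiN_le_pow_mul_exp N (by positivity)
      _ ≤ (α * τ) ^ (N - 1) * Real.exp (α * k₀) * w := by gcongr
      _ = _ := by rw [mul_pow]; ring
  · refine le_add_left ?_
    have hk : k₀ + 1 ≤ ⌈τ⌉₊ := Nat.lt_ceil.2 h
    obtain ⟨j, hj⟩ := Nat.exists_eq_add_of_le' hk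
    have hjτ : ((j + k₀ : ℕ) : ℝ) < τ := Nat.lt_ceil.1 (by omega)
    have hτj : τ ≤ (j + k₀ : ℕ) + 1 := by
      have := Nat.le_ceil τ
      rw [hj] at this
      push_cast at this ⊢
      linarith
    refine le_trans ?_ (ENNReal.le_tsum j)
    rw [Set.indicator_of_mem (by exact hjτ), ← ENNReal.ofReal_mul (by positivity)]
    refine ENNReal.ofReal_le_ofReal ?_
    gcongr
    exact (PhiN_le_exp N (by positivity)).trans (by gcongr)

lemma exists_lintegral_PhiN_le {N : ℕ} (hN : 2 ≤ N) {t : ℝ} (ht0 : 0 ≤ t) (htN : t < N) {α : ℝ}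
    (hα0 : 0 < α) (hα : α < ((N : ℝ) - t) * sphereArea N ^ (1 / ((N : ℝ) - 1))) :
    ∃ C : ℝ, 0 < C ∧ ∀ (u : Euc N → ℝ) (g : Euc N → Euc N), Measurable u → Measurable g →
      HasWeakGradient u g → ∫⁻ x, ‖g x‖ₑ ^ (N : ℝ) ≤ 1 → ∀ l : ℝ, 0 < l →
      ∫⁻ x, ENNReal.ofReal (|u x| ^ (N : ℝ) * ‖x‖ ^ (-t)) = ENNReal.ofReal (l ^ ((N : ℝ) - t)) →
      ∫⁻ x, ENNReal.ofReal (PhiN N (α * |u x| ^ ((N : ℝ) / ((N : ℝ) - 1))) * ‖x‖ ^ (-t))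
        ≤ ENNReal.ofReal C * ENNReal.ofReal (l ^ ((N : ℝ) - t)) := by
  have hNt : 0 < (N : ℝ) - t := sub_pos.2 htN
  obtain ⟨κ, hκα, hκ⟩ := exists_between ((div_lt_iff₀' hNt).2 hα)
  have hκ0 : 0 < κ := (div_pos hα0 hNt).trans hκα
  obtain ⟨D, hD0, k₀, hD⟩ := lintegral_superlevel_le hN ht0 htN hκ0 hκ
  set q : ℝ := Real.exp (α - κ * (N - t)) with hq
  have hq1 : q < 1 := by
    rw [hq, Real.exp_lt_one_iff]
    linarith [(div_lt_iff₀ hNt).1 hκα]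
  set b : ℕ → ℝ := fun j => Real.exp α * D * q ^ (j + k₀) with hb
  have hb0 : ∀ j, 0 ≤ b j := fun j => by positivity
  have hbs : Summable b := ((summable_nat_add_iff k₀).2
    (summable_geometric_of_lt_one (Real.exp_pos _).le hq1)).mul_left _
  set C₁ : ℝ := α ^ (N - 1) * Real.exp (α * k₀) with hC₁
  have hC₁0 : 0 < C₁ := by positivity
  have hC₂0 : 0 ≤ ∑' j, b j := tsum_nonneg hb0
  refine ⟨C₁ + ∑' j, b j, by positivity, fun u g hu hg hug hg1 l hl hW => ?_⟩
  set L : ℝ := l ^ ((N : ℝ) - t) with hL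
  have hL0 : 0 ≤ L := by positivity
  set τ : Euc N → ℝ := fun x => |u x| ^ ((N : ℝ) / ((N : ℝ) - 1)) with hτ
  have hτm : Measurable τ := by fun_prop
  have hwm : Measurable fun x : Euc N => ENNReal.ofReal (‖x‖ ^ (-t)) := by fun_prop
  have hlayer : ∀ k : ℕ, MeasurableSet {x | (k : ℝ) < τ x} := fun k =>
    measurableSet_lt measurable_const hτm
  set F : ℕ → Euc N → ENNReal := fun j x => ENNReal.ofReal (Real.exp (α * ((j + k₀ : ℕ) + 1))) *
    {x | ((j + k₀ : ℕ) : ℝ) < τ x}.indicator (fun x => ENNReal.ofReal (‖x‖ ^ (-t))) x with hF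
  have hFm : ∀ j, Measurable (F j) := fun j => (hwm.indicator (hlayer _)).const_mul _
  have hFint : ∀ j, ∫⁻ x, F j x ≤ ENNReal.ofReal (b j * L) := fun j => by
    rw [hF]
    simp only
    rw [lintegral_const_mul _ (hwm.indicator (hlayer _)), lintegral_indicator (hlayer _)]
    refine (mul_le_mul' le_rfl (hD u g hu hg hug hg1 l hl hW.le (j + k₀)
      (Nat.le_add_left _ _))).trans_eq ?_
    rw [← ENNReal.ofReal_mul (Real.exp_pos _).le, hb, hq]
    simp only
    rw [← Real.exp_mul, ← Real.exp_nat_mul]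
    congr 1
    have : Real.exp (α * ((j + k₀ : ℕ) + 1)) * Real.exp (-κ * (j + k₀ : ℕ) * (N - t))
        = Real.exp α * Real.exp ((j + k₀ : ℕ) * (α - κ * (N - t))) := by
      rw [← Real.exp_add, ← Real.exp_add]; congr 1; ring
    linear_combination D * L * this
  calc _ ≤ ∫⁻ x, (ENNReal.ofReal C₁ * ENNReal.ofReal (|u x| ^ (N : ℝ) * ‖x‖ ^ (-t))
        + ∑' j, F j x) := by
        refine lintegral_mono fun x => ?_
        have h := ofReal_PhiN_mul_le N hα0 (Real.rpow_nonneg (abs_nonneg (u x)) _)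
          (Real.rpow_nonneg (norm_nonneg x) (-t)) k₀ (τ := τ x)
        rwa [hτ, rpow_conjExponent_pow hN (abs_nonneg (u x))] at h
    _ = ENNReal.ofReal C₁ * ENNReal.ofReal L + ∑' j, ∫⁻ x, F j x := by
        rw [lintegral_add_left (by fun_prop), lintegral_const_mul' _ _ ENNReal.ofReal_ne_top, hW,
          lintegral_tsum fun j => (hFm j).aemeasurable]
    _ ≤ ENNReal.ofReal C₁ * ENNReal.ofReal L + ∑' j, ENNReal.ofReal (b j * L) := by
        gcongr with j; exact hFint j
    _ = _ := by
        rw [← ENNReal.ofReal_tsum_of_nonneg (fun j => mul_nonneg (hb0 j) hL0) (hbs.mul_right L),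
          tsum_mul_right, ENNReal.ofReal_mul hC₂0, ← add_mul, ENNReal.ofReal_add hC₁0.le hC₂0]

/-- **Weighted Moser–Trudinger inequality, special case `s = t` (inequality (2.1)).**
For `N ≥ 2`, `0 ≤ t < N` and `0 < α < α_{N,t} = (N-t)·ω_{N-1}^{1/(N-1)}`, there is `C > 0`
such that for every `u ∈ L^N(ℝ^N;|x|^{-t}dx) ∩ Ẇ^{1,N}(ℝ^N)` with `∫|∇u|^N ≤ 1`,
`∫ Φ_N(α|u|^{N/(N-1)})|x|^{-t} dx ≤ C ∫ |u|^N |x|^{-t} dx`. -/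
theorem weighted_moser_trudinger_PhiN_eq_weights (N : ℕ) (hN : 2 ≤ N) (t : ℝ) (ht0 : 0 ≤ t)
    (htN : t < (N : ℝ)) (α : ℝ) (hα0 : 0 < α)
    (hα : α < ((N : ℝ) - t) * sphereArea N ^ (1 / ((N : ℝ) - 1))) :
    ∃ C : ℝ, 0 < C ∧
      ∀ (u : EuclideanSpace ℝ (Fin N) → ℝ)
        (g : EuclideanSpace ℝ (Fin N) → EuclideanSpace ℝ (Fin N)),
        HasWeakGradient u g →
        (∫⁻ x, ENNReal.ofReal (|u x| ^ (N : ℝ) * ‖x‖ ^ (-t))) ≠ ⊤ →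
        (∫⁻ x, ENNReal.ofReal (‖g x‖ ^ (N : ℝ))) ≤ 1 →
        (∫⁻ x, ENNReal.ofReal (PhiN N (α * |u x| ^ ((N : ℝ) / ((N : ℝ) - 1))) * ‖x‖ ^ (-t)))
          ≤ ENNReal.ofReal C * ∫⁻ x, ENNReal.ofReal (|u x| ^ (N : ℝ) * ‖x‖ ^ (-t)) := by
  obtain ⟨C, hC0, hC⟩ := exists_lintegral_PhiN_le hN ht0 htN hα0 hα
  refine ⟨C, hC0, fun u g hug hW hg => ?_⟩
  have hum := hug.1.aestronglyMeasurable
  have hgm := hug.2.1.aestronglyMeasurable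
  set v := hum.mk u with hv
  set h := hgm.mk g with hh
  have huv : u =ᵐ[volume] v := hum.ae_eq_mk
  have hgh : g =ᵐ[volume] h := hgm.ae_eq_mk
  have hWv : ∫⁻ x, ENNReal.ofReal (|u x| ^ (N : ℝ) * ‖x‖ ^ (-t))
      = ∫⁻ x, ENNReal.ofReal (|v x| ^ (N : ℝ) * ‖x‖ ^ (-t)) :=
    lintegral_congr_ae (huv.mono fun x hx => by simp only [hx])
  have hPv : ∫⁻ x, ENNReal.ofReal (PhiN N (α * |u x| ^ ((N : ℝ) / ((N : ℝ) - 1))) * ‖x‖ ^ (-t))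
      = ∫⁻ x, ENNReal.ofReal (PhiN N (α * |v x| ^ ((N : ℝ) / ((N : ℝ) - 1))) * ‖x‖ ^ (-t)) :=
    lintegral_congr_ae (huv.mono fun x hx => by simp only [hx])
  have hh1 : ∫⁻ x, ‖h x‖ₑ ^ (N : ℝ) ≤ 1 := by
    refine (lintegral_congr_ae (hgh.mono fun x hx => ?_)).trans_le hg
    simp only [← hx]
    rw [← ofReal_norm, ENNReal.ofReal_rpow_of_nonneg (norm_nonneg _) (Nat.cast_nonneg _)]
  have hvm : Measurable v := hum.stronglyMeasurable_mk.measurable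
  have hhm : Measurable h := hgm.stronglyMeasurable_mk.measurable
  have hN' : (2 : ℝ) ≤ N := by exact_mod_cast hN
  have hNt : (N : ℝ) - t ≠ 0 := (sub_pos.2 htN).ne'
  rw [hPv, hWv]
  rw [hWv] at hW
  set W := ∫⁻ x, ENNReal.ofReal (|v x| ^ (N : ℝ) * ‖x‖ ^ (-t)) with hWdef
  rcases eq_or_ne W 0 with hW0 | hW0
  · have hae := (lintegral_eq_zero_iff (by fun_prop)).1 (hWdef.symm.trans hW0)
    have : Nonempty (Fin N) := ⟨⟨0, by omega⟩⟩
    have hne : ∀ᵐ x : EuclideanSpace ℝ (Fin N), x ≠ 0 := by simp [ae_iff, measure_singleton]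
    rw [lintegral_congr_ae (g := fun _ => 0) ?_, lintegral_zero]
    · exact zero_le
    filter_upwards [hae, hne] with x hx hx0
    have hpos := Real.rpow_pos_of_pos (norm_pos_iff.2 hx0) (-t)
    have hle : |v x| ^ (N : ℝ) ≤ 0 := by
      by_contra! hlt
      exact (ENNReal.ofReal_pos.2 (mul_pos hlt hpos)).ne' hx
    have hv0 : |v x| = 0 := by
      by_contra hne0
      exact hle.not_gt (Real.rpow_pos_of_pos (lt_of_le_of_ne' (abs_nonneg _) hne0) _)
    have hexp : (N : ℝ) / ((N : ℝ) - 1) ≠ 0 := (div_pos (by linarith) (by linarith)).ne'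
    rw [hv0, Real.zero_rpow hexp, mul_zero, PhiN_zero hN, zero_mul, ENNReal.ofReal_zero]
  · have hWpos : 0 < W.toReal := ENNReal.toReal_pos hW0 hW
    have hWl : W = ENNReal.ofReal ((W.toReal ^ ((N : ℝ) - t)⁻¹) ^ ((N : ℝ) - t)) := by
      rw [Real.rpow_inv_rpow hWpos.le hNt, ENNReal.ofReal_toReal hW]
    calc _ ≤ _ := hC v h hvm hhm (hug.congr_ae huv hgh) hh1 _ (Real.rpow_pos_of_pos hWpos _) hWl
      _ = _ := by rw [← hWl]
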